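/- Let a₁ ≥ ... ≥ a_k ≥ 1 (k ≥ 1) and b₁ ≥ 1 with h := Σaᵢ + b₁ - 1 ≥ 1, and let G be a connected graph on n ≥ 2h+3 vertices with minimum degree δ(G) ≥ h. Then G contains the disjoint union F = P_{2a₁} ∪ ... ∪ P_{2a_k} ∪ P_{2b₁+1}, unless: (i) G ⊆ S_{n,h} = K_h ∨ complement(K_{n-h}); or (ii) F = P_6 ∪ P_3, n is even, and G ⊆ K_2 ∨ (n-2)/2 · K_2; or (iii) F ∈ {P_{2b₁} ∪ P_{2b₁+1}, P_{2b₁+2} ∪ P_{2b₁+1}} and G = L_{t,h} = K_1 ∨ tK_h with n = th+1. -/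

import Mathlib

open SimpleGraph

/-- `G` embeds into `H` as a (not necessarily induced) subgraph. -/
def SubgraphOf {V W : Type*} (G : SimpleGraph V) (H : SimpleGraph W) : Prop :=
  ∃ f : V ↪ W, ∀ a b, G.Adj a b → H.Adj (f a) (f b)

/-- `G` contains a linear forest consisting of pairwise vertex-disjoint paths
with orders `L i` (`i : ι`). -/
def ContainsForest {V ι : Type*} (G : SimpleGraph V) (L : ι → ℕ) : Prop :=
  ∃ f : ∀ i, Fin (L i) → V,
    (∀ i, Function.Injective (f i)) ∧
    (∀ i j, i ≠ j → ∀ a b, f i a ≠ f j b) ∧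
    (∀ i (a : ℕ) (ha : a + 1 < L i), G.Adj (f i ⟨a, by omega⟩) (f i ⟨a + 1, ha⟩))

/-- `G` is 2-connected: more than 2 vertices and removing fewer than 2 vertices
leaves a connected graph. -/
def TwoConnected {V : Type*} [Fintype V] (G : SimpleGraph V) : Prop :=
  2 < Fintype.card V ∧
    ∀ s : Finset V, s.card < 2 → (G.induce ((s : Set V)ᶜ)).Connected

/-- `S_{n,h} = K_h ∨ \overline{K_{n-h}}`. -/
def Sgraph (n h : ℕ) : SimpleGraph (Fin n) :=
  SimpleGraph.fromRel (fun a _ => a.val < h)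

/-- `S⁺_{n,h} = K_h ∨ (K_2 ∪ \overline{K_{n-h-2}})`, the extra edge joining vertices `h` and `h+1`. -/
def SplusGraph (n h : ℕ) : SimpleGraph (Fin n) :=
  SimpleGraph.fromRel (fun a b => a.val < h ∨ (a.val ≤ h + 1 ∧ b.val ≤ h + 1))

/-- index of the clique block containing vertex `v ≥ 1` in `K_1 ∨ (t₁ K_h ∪ t₂ K_{h+1})`. -/
def blockIdx (t₁ h v : ℕ) : ℕ :=
  if v - 1 < t₁ * h then (v - 1) / h else t₁ + (v - 1 - t₁ * h) / (h + 1)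

/-- `L_{t₁,t₂,h,h+1} = K_1 ∨ (t₁ K_h ∪ t₂ K_{h+1})`; vertex `0` is the center. -/
def Lgen (t₁ t₂ h : ℕ) : SimpleGraph (Fin (t₁ * h + t₂ * (h + 1) + 1)) :=
  SimpleGraph.fromRel (fun a b =>
    a.val = 0 ∨ blockIdx t₁ h a.val = blockIdx t₁ h b.val)

/-- `U_{3,h}`: three copies of `K_{h+1}` plus a triangle on one chosen vertex of each. -/
def Ugraph (h : ℕ) : SimpleGraph (Fin (3 * (h + 1))) :=
  SimpleGraph.fromRel (fun a b =>
    a.val / (h + 1) = b.val / (h + 1) ∨ (a.val % (h + 1) = 0 ∧ b.val % (h + 1) = 0))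

/-- `K_p ∨ (m K_2)`: a clique on the first `p` vertices joined to `m` disjoint edges. -/
def KjoinMK2 (p m : ℕ) : SimpleGraph (Fin (p + 2 * m)) :=
  SimpleGraph.fromRel (fun a b => a.val < p ∨ (a.val - p) / 2 = (b.val - p) / 2)

/-- `F_{t₁,t₂,h,h+1}`: `L_{t₁,t₂,h,h+1}` plus one extra `K_{h+1}` joined to the center by an edge. -/
def Fgraph (t₁ t₂ h : ℕ) : SimpleGraph (Fin (t₁ * h + (t₂ + 1) * (h + 1) + 1)) :=
  SimpleGraph.fromRel (fun a b =>
    (a.val < t₁ * h + t₂ * (h + 1) + 1 ∧ b.val < t₁ * h + t₂ * (h + 1) + 1 ∧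
      (a.val = 0 ∨ blockIdx t₁ h a.val = blockIdx t₁ h b.val)) ∨
    (t₁ * h + t₂ * (h + 1) + 1 ≤ a.val ∧ t₁ * h + t₂ * (h + 1) + 1 ≤ b.val) ∨
    (a.val = 0 ∧ b.val = t₁ * h + t₂ * (h + 1) + 1))

/-- `T_{t₁,t₂,h,h+1}`: `L_{t₁,t₂,h,h+1}` plus two extra `K_{h+1}`'s, each joined to the center by an edge. -/
def Tgraph (t₁ t₂ h : ℕ) : SimpleGraph (Fin (t₁ * h + (t₂ + 2) * (h + 1) + 1)) :=
  SimpleGraph.fromRel (fun a b =>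
    (a.val < t₁ * h + t₂ * (h + 1) + 1 ∧ b.val < t₁ * h + t₂ * (h + 1) + 1 ∧
      (a.val = 0 ∨ blockIdx t₁ h a.val = blockIdx t₁ h b.val)) ∨
    (t₁ * h + t₂ * (h + 1) + 1 ≤ a.val ∧ a.val < t₁ * h + (t₂ + 1) * (h + 1) + 1 ∧
      t₁ * h + t₂ * (h + 1) + 1 ≤ b.val ∧ b.val < t₁ * h + (t₂ + 1) * (h + 1) + 1) ∨
    (t₁ * h + (t₂ + 1) * (h + 1) + 1 ≤ a.val ∧ t₁ * h + (t₂ + 1) * (h + 1) + 1 ≤ b.val) ∨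
    (a.val = 0 ∧ b.val = t₁ * h + t₂ * (h + 1) + 1) ∨
    (a.val = 0 ∧ b.val = t₁ * h + (t₂ + 1) * (h + 1) + 1))

/-- attach a pendant path with `m` additional vertices at the vertex `u` of `H`
(i.e. identify `u` with an endpoint of `P_{m+1}`). -/
def attachPath {V : Type*} (H : SimpleGraph V) (u : V) (m : ℕ) : SimpleGraph (V ⊕ Fin m) :=
  SimpleGraph.fromRel (fun a b =>
    (∃ x y, a = Sum.inl x ∧ b = Sum.inl y ∧ H.Adj x y) ∨
    (∃ j : Fin m, a = Sum.inl u ∧ b = Sum.inr j ∧ j.val = 0) ∨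
    (∃ i j : Fin m, a = Sum.inr i ∧ b = Sum.inr j ∧ j.val = i.val + 1))

/-! ### helper material -/

set_option linter.unusedSectionVars false

def IsP {V : Type*} (G : SimpleGraph V) (l : List V) : Prop := l.IsChain G.Adj ∧ l.Nodup

section helpers
variable {V : Type*} {G : SimpleGraph V}

theorem IsP.nil : IsP G ([] : List V) := ⟨List.isChain_nil, List.nodup_nil⟩
theorem IsP.single (x : V) : IsP G [x] := ⟨List.isChain_singleton x, List.nodup_singleton x⟩

theorem IsP.append {l₁ l₂ : List V} (h1 : IsP G l₁) (h2 : IsP G l₂)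
    (hd : ∀ x ∈ l₁, x ∉ l₂)
    (hj : ∀ x ∈ l₁.getLast?, ∀ y ∈ l₂.head?, G.Adj x y) : IsP G (l₁ ++ l₂) := by
  refine ⟨List.isChain_append.2 ⟨h1.1, h2.1, hj⟩, List.nodup_append.2 ⟨h1.2, h2.2, ?_⟩⟩
  intro a ha b hb hab
  exact hd a ha (hab ▸ hb)

theorem IsP.reverse {l : List V} (h1 : IsP G l) : IsP G l.reverse := by
  refine ⟨?_, List.nodup_reverse.2 h1.2⟩
  rw [List.isChain_reverse]
  exact h1.1.imp fun a b h => h.symm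

theorem IsP.left {l₁ l₂ : List V} (h : IsP G (l₁ ++ l₂)) : IsP G l₁ :=
  ⟨(List.isChain_append.1 h.1).1, (List.nodup_append.1 h.2).1⟩
theorem IsP.right {l₁ l₂ : List V} (h : IsP G (l₁ ++ l₂)) : IsP G l₂ :=
  ⟨(List.isChain_append.1 h.1).2.1, (List.nodup_append.1 h.2).2.1⟩
theorem IsP.take {l : List V} (h : IsP G l) (n : ℕ) : IsP G (l.take n) := by
  rw [← List.take_append_drop n l] at h; exact h.left
theorem IsP.drop {l : List V} (h : IsP G l) (n : ℕ) : IsP G (l.drop n) := by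
  rw [← List.take_append_drop n l] at h; exact h.right
theorem IsP.take_drop {l : List V} (h : IsP G l) (n : ℕ) : ∀ x ∈ l.take n, x ∉ l.drop n := by
  have := h.2
  rw [← List.take_append_drop n l] at this
  intro x hx hx'
  exact (List.nodup_append.1 this).2.2 x hx x hx' rfl

/-- distribution of the pieces of a forest over a path -/
theorem split_list {ι : Type*} [DecidableEq ι] (L : ι → ℕ) (S : Finset ι) :
    ∀ l : List V, IsP G l → (∑ i ∈ S, L i) ≤ l.length →
    ∃ g : ι → List V, (∀ i ∈ S, IsP G (g i) ∧ (g i).length = L i ∧ ∀ x ∈ g i, x ∈ l) ∧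
      ∀ i ∈ S, ∀ j ∈ S, i ≠ j → ∀ x ∈ g i, x ∉ g j := by
  induction S using Finset.induction_on with
  | empty => intro l _ _; exact ⟨fun _ => [], by simp, by simp⟩
  | insert i S hi ih =>
    intro l hl hlen
    rw [Finset.sum_insert hi] at hlen
    obtain ⟨g, hg, hgd⟩ := ih (l.drop (L i)) (hl.drop _) (by rw [List.length_drop]; omega)
    have hne : ∀ j ∈ S, j ≠ i := fun j hj h => hi (h ▸ hj)
    refine ⟨fun j => if j = i then l.take (L i) else g j, ?_, ?_⟩
    · intro j hj
      rcases Finset.mem_insert.1 hj with rfl | hj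
      · simp only [if_true]
        refine ⟨hl.take _, ?_, fun x hx => List.mem_of_mem_take hx⟩
        rw [List.length_take]; omega
      · simp only [if_neg (hne j hj)]
        exact ⟨(hg j hj).1, (hg j hj).2.1, fun x hx => List.mem_of_mem_drop ((hg j hj).2.2 x hx)⟩
    · intro j hj k hk hjk x hx
      rcases Finset.mem_insert.1 hj with rfl | hj'
      · rcases Finset.mem_insert.1 hk with rfl | hk
        · exact absurd rfl hjk
        · simp only [if_true] at hx
          simp only [if_neg (hne k hk)]
          intro hx'
          exact hl.take_drop _ x hx ((hg k hk).2.2 x hx')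
      · simp only [if_neg (hne j hj')] at hx
        rcases Finset.mem_insert.1 hk with rfl | hk'
        · simp only [if_true]
          intro hx'
          exact hl.take_drop _ x hx' ((hg j hj').2.2 x hx)
        · simp only [if_neg (hne k hk')]
          exact hgd j hj' k hk' hjk x hx

theorem forest_of_lists {ι : Type*} (L : ι → ℕ) (g : ι → List V)
    (h1 : ∀ i, IsP G (g i) ∧ (g i).length = L i)
    (h2 : ∀ i j, i ≠ j → ∀ x ∈ g i, x ∉ g j) : ContainsForest G L := by
  refine ⟨fun i a => (g i)[a.1]'(by rw [(h1 i).2]; exact a.2), ?_, ?_, ?_⟩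
  · intro i a b hab
    exact Fin.ext ((h1 i).1.2.getElem_inj_iff.1 hab)
  · intro i j hij a b hab
    dsimp only at hab
    refine h2 i j hij _ (List.getElem_mem (by rw [(h1 i).2]; exact a.2) : (g i)[a.1]'(by rw [(h1 i).2]; exact a.2) ∈ g i) ?_
    rw [hab]; exact List.getElem_mem _
  · intro i a ha
    exact List.isChain_iff_getElem.1 (h1 i).1.1 a (by rw [(h1 i).2]; exact ha)

theorem forest_split {ι : Type*} [Fintype ι] [DecidableEq ι] (L : ι → ℕ) (S : Finset ι)
    (l₁ l₂ : List V) (h1 : IsP G l₁) (h2 : IsP G l₂) (hd : ∀ x ∈ l₁, x ∉ l₂)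
    (hs1 : (∑ i ∈ S, L i) ≤ l₁.length) (hs2 : (∑ i ∈ Sᶜ, L i) ≤ l₂.length) :
    ContainsForest G L := by
  obtain ⟨g1, hg1, hd1⟩ := split_list L S l₁ h1 hs1
  obtain ⟨g2, hg2, hd2⟩ := split_list L Sᶜ l₂ h2 hs2
  refine forest_of_lists L (fun i => if i ∈ S then g1 i else g2 i) ?_ ?_
  · intro i
    by_cases hi : i ∈ S
    · simp only [hi, if_true]; exact ⟨(hg1 i hi).1, (hg1 i hi).2.1⟩
    · simp only [hi, if_false]
      have := hg2 i (Finset.mem_compl.2 hi)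
      exact ⟨this.1, this.2.1⟩
  · intro i j hij x hx
    by_cases hi : i ∈ S <;> by_cases hj : j ∈ S <;> simp only [hi, hj, if_true, if_false] at hx ⊢
    · exact hd1 i hi j hj hij x hx
    · intro hx'
      exact hd x ((hg1 i hi).2.2 x hx) ((hg2 j (Finset.mem_compl.2 hj)).2.2 x hx')
    · intro hx'
      exact hd x ((hg1 j hj).2.2 x hx') ((hg2 i (Finset.mem_compl.2 hi)).2.2 x hx)
    · exact hd2 i (Finset.mem_compl.2 hi) j (Finset.mem_compl.2 hj) hij x hx

def HasPair (G : SimpleGraph V) (s t : ℕ) : Prop :=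
  ∃ l₁ l₂ : List V, IsP G l₁ ∧ IsP G l₂ ∧ (∀ x ∈ l₁, x ∉ l₂) ∧ s ≤ l₁.length ∧ t ≤ l₂.length

theorem HasPair.mono {s t s' t' : ℕ} (h : HasPair G s t) (hs : s' ≤ s) (ht : t' ≤ t) :
    HasPair G s' t' := by
  obtain ⟨l₁, l₂, a, b, c, d, e⟩ := h
  exact ⟨l₁, l₂, a, b, c, by omega, by omega⟩

theorem HasPair.symm {s t : ℕ} (h : HasPair G s t) : HasPair G t s := by
  obtain ⟨l₁, l₂, a, b, c, d, e⟩ := h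
  exact ⟨l₂, l₁, b, a, fun x hx hx' => c x hx' hx, e, d⟩

theorem pair_sum {k : ℕ} (a : Fin k → ℕ) (b : ℕ)
    (hp : HasPair G (2 * ∑ i, a i) (2 * b + 1)) :
    ContainsForest G (Sum.elim (fun i : Fin k => 2 * a i) (fun _ : Fin 1 => 2 * b + 1)) := by
  obtain ⟨l₁, l₂, h1, h2, h3, h4, h5⟩ := hp
  have e : (∑ i : Fin k ⊕ Fin 1, Sum.elim (fun i : Fin k => 2 * a i) (fun _ : Fin 1 => 2 * b + 1) i)
     = 2 * (∑ i, a i) + (2 * b + 1) := by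
    rw [Fintype.sum_sum_type]; simp [Finset.mul_sum]
  have e2 := Finset.sum_add_sum_compl ({Sum.inr 0} : Finset (Fin k ⊕ Fin 1))
    (Sum.elim (fun i : Fin k => 2 * a i) (fun _ : Fin 1 => 2 * b + 1))
  refine forest_split _ {Sum.inr 0} l₂ l₁ h2 h1 (fun x hx hx' => h3 x hx' hx) ?_ ?_
  · simpa using h5
  · rw [e] at e2
    simp only [Finset.sum_singleton, Sum.elim_inr] at e2
    omega

theorem pair_one {k : ℕ} (a : Fin k → ℕ) (b h : ℕ) (hsum : (∑ i, a i) + b = h + 1) (i : Fin k)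
    (hp : HasPair G (2 * a i) (2 * h + 3 - 2 * a i)) :
    ContainsForest G (Sum.elim (fun i : Fin k => 2 * a i) (fun _ : Fin 1 => 2 * b + 1)) := by
  obtain ⟨l₁, l₂, h1, h2, h3, h4, h5⟩ := hp
  have e : (∑ i : Fin k ⊕ Fin 1, Sum.elim (fun i : Fin k => 2 * a i) (fun _ : Fin 1 => 2 * b + 1) i)
     = 2 * (∑ i, a i) + (2 * b + 1) := by
    rw [Fintype.sum_sum_type]; simp [Finset.mul_sum]
  have e2 := Finset.sum_add_sum_compl ({Sum.inl i} : Finset (Fin k ⊕ Fin 1))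
    (Sum.elim (fun i : Fin k => 2 * a i) (fun _ : Fin 1 => 2 * b + 1))
  refine forest_split _ {Sum.inl i} l₁ l₂ h1 h2 h3 ?_ ?_
  · simpa using h4
  · rw [e] at e2
    simp only [Finset.sum_singleton, Sum.elim_inl] at e2
    omega

theorem conn_closed (hc : G.Connected) (T : Set V) (x0 : V) (h0 : x0 ∈ T)
    (hT : ∀ x ∈ T, ∀ y, G.Adj x y → y ∈ T) (y : V) : y ∈ T := by
  obtain ⟨w⟩ := hc.preconnected x0 y
  induction w with
  | nil => exact h0
  | cons hadj _ ih => exact ih (hT _ h0 _ hadj)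

/-- combinatorial lemma on spaced sets -/
theorem comb (J : Finset ℕ) (c m : ℕ) (hJ : ∀ j ∈ J, c ≤ j ∧ j < c + 2 * m)
    (hsp : ∀ i ∈ J, ∀ j ∈ J, i < j → i + 2 ≤ j) (hm : m ≤ J.card) :
    J.card = m ∧ ∃ s ≤ m, (∀ t < s, c + 2 * t ∈ J) ∧ ∀ t, s ≤ t → t < m → c + 2 * t + 1 ∈ J := by
  have hinj : Set.InjOn (fun j => (j - c) / 2) (J : Set ℕ) := by
    intro i hi j hj hij
    have := hsp i hi j hj; have := hsp j hj i hi
    have := hJ i hi; have := hJ j hj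
    dsimp only at hij
    omega
  have hcard : (J.image (fun j => (j - c) / 2)).card = J.card := Finset.card_image_of_injOn hinj
  have hsub : J.image (fun j => (j - c) / 2) ⊆ Finset.range m := by
    intro t ht
    obtain ⟨j, hj, rfl⟩ := Finset.mem_image.1 ht
    have := hJ j hj
    rw [Finset.mem_range]; omega
  have heq : J.image (fun j => (j - c) / 2) = Finset.range m :=
    Finset.eq_of_subset_of_card_le hsub (by rw [hcard, Finset.card_range]; exact hm)
  have hor : ∀ t < m, c + 2 * t ∈ J ∨ c + 2 * t + 1 ∈ J := by
    intro t ht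
    have : t ∈ J.image (fun j => (j - c) / 2) := by rw [heq]; exact Finset.mem_range.2 ht
    obtain ⟨j, hj, hjt⟩ := Finset.mem_image.1 this
    have := hJ j hj
    have : j = c + 2 * t ∨ j = c + 2 * t + 1 := by omega
    rcases this with rfl | rfl
    · exact Or.inl hj
    · exact Or.inr hj
  refine ⟨by rw [← hcard, heq, Finset.card_range], ?_⟩
  have gen : ∀ r ≤ m, ∃ s ≤ r, (∀ t < s, c + 2 * t ∈ J) ∧
      ∀ t, s ≤ t → t < r → c + 2 * t + 1 ∈ J := by
    intro r
    induction r with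
    | zero => intro _; exact ⟨0, le_rfl, by simp, by simp⟩
    | succ r ihr =>
      intro hr
      obtain ⟨s, hs, h1, h2⟩ := ihr (by omega)
      by_cases hsr : s = r
      · subst hsr
        rcases hor s (by omega) with h | h
        · refine ⟨s + 1, le_rfl, fun t ht => ?_, by omega⟩
          by_cases hts : t = s
          · rw [hts]; exact h
          · exact h1 t (by omega)
        · refine ⟨s, by omega, h1, fun t ht ht' => ?_⟩
          have : t = s := by omega
          rw [this]; exact h
      · refine ⟨s, by omega, h1, fun t ht ht' => ?_⟩
        by_cases htr : t = r
        · rw [htr]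
          refine (hor r (by omega)).resolve_left fun h => ?_
          have := h2 (r - 1) (by omega) (by omega)
          have := hsp _ this _ h (by omega)
          omega
        · exact h2 t ht (by omega)
  exact gen m le_rfl

end helpers
section paths
variable {V : Type*} {G : SimpleGraph V}

def seg (v : ℕ → V) (i j : ℕ) : List V := (List.range' i (j - i)).map v

theorem mem_seg {v : ℕ → V} {i j : ℕ} {x : V} : x ∈ seg v i j ↔ ∃ t, i ≤ t ∧ t < j ∧ v t = x := by
  unfold seg
  rw [List.mem_map]
  constructor
  · rintro ⟨t, ht, rfl⟩
    rw [List.mem_range'_1] at ht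
    exact ⟨t, ht.1, by omega, rfl⟩
  · rintro ⟨t, h1, h2, rfl⟩
    exact ⟨t, by rw [List.mem_range'_1]; omega, rfl⟩

theorem length_seg (v : ℕ → V) (i j : ℕ) : (seg v i j).length = j - i := by
  simp [seg]

theorem head_seg {v : ℕ → V} {i j : ℕ} {x : V} (h : x ∈ (seg v i j).head?) : i < j ∧ x = v i := by
  unfold seg at h
  rcases hd : j - i with _ | d
  · rw [hd] at h; simp at h
  · rw [hd, List.range'_succ] at h; simp at h
    exact ⟨by omega, h.symm⟩

theorem last_seg {v : ℕ → V} {i j : ℕ} {x : V} (h : x ∈ (seg v i j).getLast?) :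
    i < j ∧ x = v (j - 1) := by
  unfold seg at h
  rcases hd : j - i with _ | d
  · rw [hd] at h; simp at h
  · rw [hd, List.range'_1_concat] at h; simp at h
    refine ⟨by omega, ?_⟩
    rw [← h]; congr 1; omega

structure Lng (G : SimpleGraph V) (v : ℕ → V) (p : ℕ) : Prop where
  inj : ∀ i < p, ∀ j < p, v i = v j → i = j
  adj : ∀ i, i + 1 < p → G.Adj (v i) (v (i + 1))
  mx : ∀ l : List V, IsP G l → l.length ≤ p

def Out (v : ℕ → V) (p : ℕ) (x : V) : Prop := ∀ i < p, v i ≠ x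

theorem Lng.seg {v : ℕ → V} {p : ℕ} (H : Lng G v p) {i j : ℕ} (hj : j ≤ p) : IsP G (seg v i j) := by
  constructor
  · unfold _root_.seg
    rw [List.isChain_iff_getElem]
    intro k hk
    simp only [List.length_map, List.length_range'] at hk
    simp only [List.getElem_map, List.getElem_range', one_mul]
    exact H.adj (i + k) (by omega)
  · unfold _root_.seg
    refine List.Nodup.map_on ?_ (List.nodup_range')
    intro x hx y hy hxy
    rw [List.mem_range'_1] at hx hy
    exact H.inj x (by omega) y (by omega) hxy

theorem Lng.disj {v : ℕ → V} {p : ℕ} (H : Lng G v p) {i j i' j' : ℕ} (hj : j ≤ i') (hj' : j' ≤ p) :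
    ∀ x ∈ _root_.seg v i j, x ∉ _root_.seg v i' j' := by
  intro x hx hx'
  obtain ⟨t, h1, h2, rfl⟩ := mem_seg.1 hx
  obtain ⟨t', h1', h2', h3⟩ := mem_seg.1 hx'
  have := H.inj t' (by omega) t (by omega) h3
  omega

theorem Lng.rev {v : ℕ → V} {p : ℕ} (H : Lng G v p) : Lng G (fun i => v (p - 1 - i)) p := by
  refine ⟨?_, ?_, H.mx⟩
  · intro i hi j hj h
    have := H.inj _ (by omega) _ (by omega) h
    omega
  · intro i hi
    have := H.adj (p - 1 - (i + 1)) (by omega)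
    have e : p - 1 - (i + 1) + 1 = p - 1 - i := by omega
    rw [e] at this
    exact this.symm

theorem Out.rev {v : ℕ → V} {p : ℕ} {x : V} (h : Out v p x) : Out (fun i => v (p - 1 - i)) p x := by
  intro i hi; exact h _ (by omega)

theorem Out.seg {v : ℕ → V} {p : ℕ} {x : V} (h : Out v p x) {i j : ℕ} (hj : j ≤ p) :
    x ∉ _root_.seg v i j := by
  intro hx
  obtain ⟨t, h1, h2, h3⟩ := mem_seg.1 hx
  exact h t (by omega) h3

structure Att (G : SimpleGraph V) (v : ℕ → V) (p : ℕ) (Q : List V) (j : ℕ) (u w : V) : Prop where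
  isP : IsP G Q
  out : ∀ x ∈ Q, Out v p x
  hj : j < p
  hu : Q.head? = some u
  hw : Q.getLast? = some w
  adj : G.Adj (v j) u

theorem Att.memu {v : ℕ → V} {p : ℕ} {Q j u w} (A : Att G v p Q j u w) : u ∈ Q :=
  List.mem_of_mem_head? A.hu
theorem Att.memw {v : ℕ → V} {p : ℕ} {Q j u w} (A : Att G v p Q j u w) : w ∈ Q :=
  List.mem_of_mem_getLast? A.hw
theorem Att.pos {v : ℕ → V} {p : ℕ} {Q j u w} (A : Att G v p Q j u w) : 1 ≤ Q.length :=
  List.length_pos_of_mem A.memu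

theorem Att.rev {v : ℕ → V} {p : ℕ} {Q j u w} (A : Att G v p Q j u w) {i : ℕ} (hi : i < p)
    (ha : G.Adj (v i) w) : Att G v p Q.reverse i w u :=
  ⟨A.isP.reverse, fun x hx => A.out x (List.mem_reverse.1 hx), hi, by simp [A.hw], by simp [A.hu], ha⟩

/-- first pair: initial segment plus Q -/
theorem Att.listL {v : ℕ → V} {p : ℕ} (H : Lng G v p) {Q j u w} (A : Att G v p Q j u w) :
    IsP G (seg v 0 (j + 1) ++ Q) := by
  have := A.hj
  refine (H.seg (by omega)).append A.isP ?_ ?_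
  · intro x hx hx'; exact (A.out x hx').seg (by omega) hx
  · intro x hx y hy
    obtain ⟨_, rfl⟩ := last_seg hx
    rw [A.hu] at hy; cases hy
    exact A.adj

theorem Att.listR {v : ℕ → V} {p : ℕ} (H : Lng G v p) {Q j u w} (A : Att G v p Q j u w) :
    IsP G (Q.reverse ++ seg v j p) := by
  refine A.isP.reverse.append (H.seg le_rfl) ?_ ?_
  · intro x hx; exact (A.out x (List.mem_reverse.1 hx)).seg le_rfl
  · intro x hx y hy
    obtain ⟨_, rfl⟩ := head_seg hy
    rw [List.getLast?_reverse, A.hu] at hx; cases hx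
    exact A.adj.symm

theorem Att.bounds {v : ℕ → V} {p : ℕ} (H : Lng G v p) {Q j u w} (A : Att G v p Q j u w) :
    Q.length ≤ j ∧ j + Q.length + 1 ≤ p := by
  have h1 := H.mx _ (A.listL H)
  have h2 := H.mx _ (A.listR H)
  have := A.hj
  simp only [List.length_append, length_seg, List.length_reverse] at h1 h2
  omega

theorem Att.pair1 {v : ℕ → V} {p : ℕ} (H : Lng G v p) {Q j u w} (A : Att G v p Q j u w) :
    HasPair G (j + 1 + Q.length) (p - (j + 1)) := by
  refine ⟨_, seg v (j + 1) p, A.listL H, H.seg le_rfl, ?_, ?_, ?_⟩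
  · intro x hx
    rcases List.mem_append.1 hx with hx | hx
    · exact H.disj le_rfl le_rfl x hx
    · exact (A.out x hx).seg le_rfl
  · simp only [List.length_append, length_seg]; omega
  · rw [length_seg]

theorem Att.pair2 {v : ℕ → V} {p : ℕ} (H : Lng G v p) {Q j u w} (A : Att G v p Q j u w) :
    HasPair G (Q.length + (p - j)) j := by
  have := A.hj
  refine ⟨_, seg v 0 j, A.listR H, H.seg (by omega), ?_, ?_, ?_⟩
  · intro x hx
    rcases List.mem_append.1 hx with hx | hx
    · exact (A.out x (List.mem_reverse.1 hx)).seg (by omega)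
    · exact fun h => H.disj le_rfl le_rfl x h hx
  · simp only [List.length_append, length_seg, List.length_reverse]; omega
  · rw [length_seg]; omega

/-- insertion of `Q` between two positions -/
theorem ins {v : ℕ → V} {p : ℕ} (H : Lng G v p) {Q : List V} {u w : V} (hQ : IsP G Q)
    (hout : ∀ x ∈ Q, Out v p x) (hu : Q.head? = some u) (hw : Q.getLast? = some w)
    {i j k : ℕ} (hij : i ≤ j) (hj : j ≤ p) (hk : k ≤ p) (h1 : 0 < i → G.Adj (v (i - 1)) u)
    (h2 : j < k → G.Adj w (v j)) : IsP G (seg v 0 i ++ (Q ++ seg v j k)) := by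
  refine (H.seg (by omega)).append (hQ.append (H.seg hk) ?_ ?_) ?_ ?_
  · intro x hx; exact (hout x hx).seg hk
  · intro x hx y hy
    obtain ⟨h, rfl⟩ := head_seg hy
    rw [hw] at hx; cases hx
    exact h2 h
  · intro x hx hx'
    rcases List.mem_append.1 hx' with hx' | hx'
    · exact (hout x hx').seg (by omega) hx
    · exact H.disj hij hk x hx hx'
  · intro x hx y hy
    obtain ⟨h, rfl⟩ := last_seg hx
    rw [List.head?_append, hu] at hy; cases hy
    exact h1 h

theorem Att.space {v : ℕ → V} {p : ℕ} (H : Lng G v p) {Q j u w} (A : Att G v p Q j u w)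
    {i : ℕ} (hi : i < p) (ha : G.Adj (v i) w) : i = j ∨ i + Q.length + 1 ≤ j ∨ j + Q.length + 1 ≤ i := by
  have hjp := A.hj
  rcases lt_trichotomy i j with h | h | h
  · have B := A.rev hi ha
    have := H.mx _ (ins H B.isP B.out B.hu B.hw (i := i + 1) (j := j) (k := p) (by omega) (by omega) le_rfl
      (fun _ => B.adj) (fun _ => A.adj.symm))
    simp only [List.length_append, length_seg, List.length_reverse] at this
    omega
  · exact Or.inl h
  · have := H.mx _ (ins H A.isP A.out A.hu A.hw (i := j + 1) (j := i) (k := p) (by omega) (by omega) le_rfl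
      (fun _ => A.adj) (fun _ => ha.symm))
    simp only [List.length_append, length_seg] at this
    omega

theorem Att.single {v : ℕ → V} {p : ℕ} {u : V} {j : ℕ} (hu : Out v p u) (hj : j < p)
    (ha : G.Adj (v j) u) : Att G v p [u] j u u :=
  ⟨IsP.single u, by simpa using hu, hj, rfl, rfl, ha⟩

theorem Att.snoc {v : ℕ → V} {p : ℕ} {Q j u w} (A : Att G v p Q j u w) {z : V} (hz : Out v p z)
    (hzQ : z ∉ Q) (ha : G.Adj w z) : Att G v p (Q ++ [z]) j u z := by
  refine ⟨A.isP.append (IsP.single z) ?_ ?_, ?_, A.hj, ?_, by simp, A.adj⟩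
  · intro x hx hx'
    rw [List.mem_singleton] at hx'; exact hzQ (hx' ▸ hx)
  · intro x hx y hy
    rw [A.hw] at hx; cases hx; simp at hy; subst hy; exact ha
  · intro x hx
    rcases List.mem_append.1 hx with hx | hx
    · exact A.out x hx
    · rw [List.mem_singleton] at hx; exact hx ▸ hz
  · rw [List.head?_append, A.hu]; rfl

def NonExt (G : SimpleGraph V) (v : ℕ → V) (p : ℕ) (Q : List V) (w : V) : Prop :=
  ∀ z, G.Adj w z → Out v p z → z ∈ Q

theorem Att.extend {v : ℕ → V} {p : ℕ} (H : Lng G v p) : ∀ (d : ℕ) {Q j u w}, Att G v p Q j u w →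
    p ≤ Q.length + d →
    ∃ Q' w', Att G v p Q' j u w' ∧ Q.length ≤ Q'.length ∧ NonExt G v p Q' w' := by
  intro d
  induction d with
  | zero => intro Q j u w A hd; have := A.bounds H; omega
  | succ d ih =>
    intro Q j u w A hd
    by_cases hn : NonExt G v p Q w
    · exact ⟨Q, w, A, le_rfl, hn⟩
    · unfold NonExt at hn; push Not at hn
      obtain ⟨z, h1, h2, h3⟩ := hn
      obtain ⟨Q', w', h4, h5, h6⟩ := ih (A.snoc h2 h3 h1) (by simp; omega)
      exact ⟨Q', w', h4, by simp at h5; omega, h6⟩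

/-- maximum length attached path -/
theorem Att.maxi {v : ℕ → V} {p : ℕ} (H : Lng G v p) : ∀ (d : ℕ) {Q j u w}, Att G v p Q j u w →
    p ≤ Q.length + d →
    ∃ Q' j' u' w', Att G v p Q' j' u' w' ∧
      ∀ Q₂ j₂ u₂ w₂, Att G v p Q₂ j₂ u₂ w₂ → Q₂.length ≤ Q'.length := by
  intro d
  induction d with
  | zero => intro Q j u w A hd; have := A.bounds H; omega
  | succ d ih =>
    intro Q j u w A hd
    by_cases hn : ∀ Q₂ j₂ u₂ w₂, Att G v p Q₂ j₂ u₂ w₂ → Q₂.length ≤ Q.length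
    · exact ⟨Q, j, u, w, A, hn⟩
    · push Not at hn
      obtain ⟨Q₂, j₂, u₂, w₂, B, hB⟩ := hn
      exact ih B (by omega)

theorem Att.nonext_of_max {v : ℕ → V} {p : ℕ} {Q j u w} (A : Att G v p Q j u w)
    (hm : ∀ Q₂ j₂ u₂ w₂, Att G v p Q₂ j₂ u₂ w₂ → Q₂.length ≤ Q.length) : NonExt G v p Q w := by
  intro z hz ho
  by_contra hc
  have := hm _ _ _ _ (A.snoc ho hc hz)
  simp at this

variable [Fintype V] [DecidableEq V] [DecidableRel G.Adj]

def Jset (G : SimpleGraph V) [DecidableRel G.Adj] (v : ℕ → V) (p : ℕ) (w : V) : Finset ℕ :=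
  (Finset.range p).filter fun i => G.Adj (v i) w

theorem mem_J {v : ℕ → V} {p : ℕ} {w : V} {i : ℕ} : i ∈ Jset G v p w ↔ i < p ∧ G.Adj (v i) w := by
  simp [Jset]

theorem core {v : ℕ → V} {p h : ℕ} (H : Lng G v p) (hp : p ≤ 2 * h + 2) (hδ : ∀ x, h ≤ G.degree x)
    {Q j u w} (A : Att G v p Q j u w) (hn : NonExt G v p Q w) :
    Q.length ≤ h ∧ (∀ i ∈ Jset G v p w, Q.length ≤ i ∧ i + Q.length + 1 ≤ p) ∧
    (∀ i ∈ Jset G v p w, ∀ k ∈ Jset G v p w, i < k → i + 2 ≤ k) ∧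
    (∃ s ≤ h + 1 - Q.length, (∀ t < s, Q.length + 2 * t ∈ Jset G v p w) ∧
      ∀ t, s ≤ t → t < h + 1 - Q.length → Q.length + 2 * t + 1 ∈ Jset G v p w) ∧
    (∀ z, G.Adj w z ↔ (∃ i ∈ Jset G v p w, v i = z) ∨ (z ∈ Q ∧ z ≠ w)) := by
  have hb := A.bounds H
  have hl : Q.length ≤ h := by omega
  have hJ1 : ∀ i ∈ Jset G v p w, Q.length ≤ i ∧ i + Q.length + 1 ≤ p := by
    intro i hi
    rw [mem_J] at hi
    have := (A.rev hi.1 hi.2).bounds H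
    simpa using this
  have hJ2 : ∀ i ∈ Jset G v p w, ∀ k ∈ Jset G v p w, i < k → i + 2 ≤ k := by
    intro i hi k hk hik
    rw [mem_J] at hi hk
    have := (Att.single (A.out w A.memw) hi.1 hi.2).space H hk.1 hk.2
    simp at this
    omega
  have hsub : G.neighborFinset w ⊆ (Jset G v p w).image v ∪ Q.toFinset.erase w := by
    intro z hz
    rw [SimpleGraph.mem_neighborFinset] at hz
    rw [Finset.mem_union]
    by_cases ho : Out v p z
    · right
      rw [Finset.mem_erase, List.mem_toFinset]
      exact ⟨hz.ne', hn z hz ho⟩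
    · left
      unfold Out at ho; push Not at ho
      obtain ⟨i, hi, rfl⟩ := ho
      exact Finset.mem_image.2 ⟨i, mem_J.2 ⟨hi, hz.symm⟩, rfl⟩
  have hQc : (Q.toFinset.erase w).card = Q.length - 1 := by
    rw [Finset.card_erase_of_mem (List.mem_toFinset.2 A.memw), List.toFinset_card_of_nodup A.isP.2]
  have hpos := A.pos
  have h3 := Finset.card_union_le ((Jset G v p w).image v) (Q.toFinset.erase w)
  have h4 : ((Jset G v p w).image v).card ≤ (Jset G v p w).card := Finset.card_image_le
  have h5 := Finset.card_le_card hsub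
  have h6 := hδ w
  rw [← SimpleGraph.card_neighborFinset_eq_degree] at h6
  obtain ⟨hc, hs⟩ := comb (Jset G v p w) Q.length (h + 1 - Q.length)
    (fun i hi => by have := hJ1 i hi; omega) hJ2 (by omega)
  refine ⟨hl, hJ1, hJ2, hs, ?_⟩
  have heq := Finset.eq_of_subset_of_card_le hsub (by omega)
  intro z
  rw [← SimpleGraph.mem_neighborFinset, heq, Finset.mem_union, Finset.mem_image, Finset.mem_erase,
    List.mem_toFinset, and_comm (a := z ≠ w)]

theorem exists_att (hc : G.Connected) {v : ℕ → V} {p : ℕ} (hp : 0 < p) {x : V} (hx : Out v p x) :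
    ∃ u j, Out v p u ∧ j < p ∧ G.Adj (v j) u := by
  by_contra hcon
  push Not at hcon
  have := conn_closed hc {y | ¬ Out v p y} (v 0) (fun h => h 0 hp rfl) ?_ x
  · exact this hx
  · intro a ha b hab hb
    apply ha
    intro i hi hia
    exact hcon b i hb hi (hia ▸ hab)

/-- general bound -/
theorem p_ge (hc : G.Connected) {v : ℕ → V} {p h : ℕ} (H : Lng G v p) (hp0 : 0 < p)
    (hp : p ≤ 2 * h + 2) (hδ : ∀ x, h ≤ G.degree x) {x : V} (hx : Out v p x) : 2 * h + 1 ≤ p := by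
  obtain ⟨u, j, h1, h2, h3⟩ := exists_att hc hp0 hx
  obtain ⟨Q, w, A, _, hn⟩ := (Att.single h1 h2 h3).extend H p (by omega)
  obtain ⟨hl, hJ1, -, ⟨s, hs, hs1, hs2⟩, -⟩ := core H hp hδ A hn
  rcases Nat.lt_or_ge (h - Q.length) s with h4 | h4
  · have := hJ1 _ (hs1 (h - Q.length) h4); omega
  · have := hJ1 _ (hs2 (h - Q.length) h4 (by omega)); omega

end paths
section cases
variable {V : Type*} {G : SimpleGraph V} [Fintype V] [DecidableEq V] [DecidableRel G.Adj]

theorem caseA {v : ℕ → V} {p h : ℕ} (H : Lng G v p) (hp : p = 2 * h + 2) (hδ : ∀ x, h ≤ G.degree x)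
    {j u} (A : Att G v p [u] j u u) (hn : NonExt G v p [u] u) {a : ℕ} (ha1 : 1 ≤ a) (hah : a ≤ h) :
    HasPair G (2 * a) (2 * h + 3 - 2 * a) := by
  obtain ⟨hl, hJ1, -, ⟨s, hs, hs1, hs2⟩, -⟩ := core H (by omega) hδ A hn
  simp only [List.length_singleton] at *
  have hu : Out v p u := A.out u (by simp)
  have hou : ∀ x ∈ [u], Out v p x := by simpa using hu
  rcases Nat.lt_or_ge s a with h1 | h1
  · have h2 := mem_J.1 (hs2 (a - 1) (by omega) (by omega))
    have e : 1 + 2 * (a - 1) + 1 = 2 * a := by omega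
    rw [e] at h2
    exact ((Att.single hu h2.1 h2.2).pair2 H).symm.mono le_rfl (by simp; omega)
  · have h2 := mem_J.1 (hs1 (s - a) (by omega))
    refine ⟨seg v (2 * s + 2 - 2 * a) (2 * s + 2), seg v 0 (2 * s + 2 - 2 * a) ++ ([u] ++ seg v (2 * s + 2) p),
      H.seg (by omega), ?_, ?_, ?_, ?_⟩
    · refine ins H (IsP.single u) hou rfl rfl (by omega) (by omega) le_rfl ?_ ?_
      · intro _
        have e : 1 + 2 * (s - a) = 2 * s + 2 - 2 * a - 1 := by omega
        rw [← e]; exact h2.2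
      · intro h3
        have := (mem_J.1 (hs2 s le_rfl (by omega))).2
        have e : 1 + 2 * s + 1 = 2 * s + 2 := by omega
        rw [e] at this; exact this.symm
    · intro x hx hx'
      rcases List.mem_append.1 hx' with h3 | h3
      · exact H.disj le_rfl (by omega) x h3 hx
      · rcases List.mem_append.1 h3 with h3 | h3
        · exact (hou x h3).seg (by omega) hx
        · exact H.disj le_rfl le_rfl x hx h3
    · rw [length_seg]; omega
    · simp only [List.length_append, length_seg, List.length_singleton]; omega

theorem caseB {v : ℕ → V} {p h : ℕ} (H : Lng G v p) (hp : p = 2 * h + 2)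
    {Q j u w} (A : Att G v p Q j u w) (hQ : Q.length = h) {a : ℕ} (ha1 : 1 ≤ a) (hah : a ≤ h) :
    HasPair G (2 * a) (2 * h + 3 - 2 * a) := by
  have hb := A.bounds H
  have key : HasPair G (2 * h + 2) h ∧ HasPair G (2 * h + 1) (h + 1) := by
    have : j = h ∨ j = h + 1 := by omega
    rcases this with rfl | rfl
    · exact ⟨(A.pair2 H).mono (by omega) (by omega), (A.pair1 H).mono (by omega) (by omega)⟩
    · exact ⟨(A.pair1 H).mono (by omega) (by omega), (A.pair2 H).mono (by omega) (by omega)⟩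
  rcases Nat.lt_or_ge h (2 * a) with h1 | h1
  · rcases Nat.lt_or_ge (h + 1) (2 * a) with h2 | h2
    · exact key.2.mono (by omega) (by omega)
    · exact key.2.symm.mono (by omega) (by omega)
  · exact key.1.symm.mono (by omega) (by omega)

theorem rot {v : ℕ → V} {p : ℕ} (H : Lng G v p) {R : List V} (hR : IsP G R) {u : V} (hu : Out v p u)
    (huR : u ∉ R) {a b k : ℕ} (hab : a < b) (hbk : b ≤ k) (hk : k ≤ p)
    (hR1 : ∀ x ∈ R, x ∉ seg v a p) (hR2 : ∀ x ∈ R.getLast?, G.Adj x (v (b - 1)))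
    (h1 : G.Adj u (v a)) (h2 : k < p → G.Adj u (v k)) :
    IsP G (R ++ ((seg v a b).reverse ++ ([u] ++ seg v k p))) := by
  have hsub : ∀ x ∈ seg v k p, x ∈ seg v a p := by
    intro x hx
    obtain ⟨t, q1, q2, q3⟩ := mem_seg.1 hx
    exact mem_seg.2 ⟨t, by omega, q2, q3⟩
  have hsub' : ∀ x ∈ seg v a b, x ∈ seg v a p := by
    intro x hx
    obtain ⟨t, q1, q2, q3⟩ := mem_seg.1 hx
    exact mem_seg.2 ⟨t, by omega, by omega, q3⟩
  refine hR.append ((H.seg (by omega)).reverse.append ((IsP.single u).append (H.seg le_rfl) ?_ ?_) ?_ ?_) ?_ ?_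
  · intro x hx; rw [List.mem_singleton] at hx; subst hx; exact hu.seg le_rfl
  · intro x hx y hy
    obtain ⟨h3, rfl⟩ := head_seg hy
    simp at hx; subst hx; exact h2 h3
  · intro x hx hx'
    rw [List.mem_reverse] at hx
    rcases List.mem_append.1 hx' with h3 | h3
    · rw [List.mem_singleton] at h3; subst h3; exact hu.seg (by omega) hx
    · exact H.disj hbk le_rfl x hx h3
  · intro x hx y hy
    rw [List.getLast?_reverse] at hx
    obtain ⟨_, rfl⟩ := head_seg hx
    simp at hy; subst hy; exact h1.symm
  · intro x hx hx'
    rcases List.mem_append.1 hx' with h3 | h3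
    · exact hR1 x hx (hsub' x (List.mem_reverse.1 h3))
    · rcases List.mem_append.1 h3 with h3 | h3
      · rw [List.mem_singleton] at h3; subst h3; exact huR hx
      · exact hR1 x hx (hsub x h3)
  · intro x hx y hy
    rw [List.head?_append, List.head?_reverse] at hy
    rcases hg : (seg v a b).getLast? with _ | z
    · have h3 : (seg v a b) = [] := List.getLast?_eq_none_iff.1 hg
      have := length_seg v a b
      rw [h3] at this; simp at this; omega
    · rw [hg] at hy
      cases hy
      obtain ⟨_, rfl⟩ := last_seg hg
      exact hR2 x hx

theorem exists_att_edge (hc : G.Connected) {v : ℕ → V} {p : ℕ} (hp : 0 < p) {x y : V} (hx : Out v p x)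
    (hy : Out v p y) (hxy : G.Adj x y) :
    ∃ u j z, Out v p u ∧ j < p ∧ G.Adj (v j) u ∧ Out v p z ∧ G.Adj u z := by
  by_contra hcon
  push Not at hcon
  have := conn_closed hc {a | Out v p a ∧ ∃ b, Out v p b ∧ G.Adj a b} x ⟨hx, y, hy, hxy⟩ ?_ (v 0)
  · exact this.1 0 hp rfl
  · rintro a ⟨ha, b, hb, hab⟩ c hac
    have hc : Out v p c := by
      intro i hi hic
      exact hcon a i b ha hi (hic ▸ hac.symm) hb hab
    exact ⟨hc, a, ha, hac.symm⟩

theorem caseS (hconn : G.Connected) {v : ℕ → V} {p h : ℕ} (H : Lng G v p) (hp : p = 2 * h + 1)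
    (hδ : ∀ x, h ≤ G.degree x) {j u} (A : Att G v p [u] j u u) (hn : NonExt G v p [u] u) :
    ∃ X : Finset V, X.card = h ∧ ∀ a b, G.Adj a b → a ∈ X ∨ b ∈ X := by
  obtain ⟨hl, hJ1, hJsp, ⟨s, hs, hs1, hs2⟩, hN⟩ := core H (by omega) hδ A hn
  simp only [List.length_singleton] at *
  have hu : Out v p u := A.out u (by simp)
  have hsh : s = h := by
    by_contra hne
    have := hJ1 _ (hs2 (h - 1) (by omega) (by omega)); omega
  have hodd : ∀ i < p, i % 2 = 1 → G.Adj u (v i) := by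
    intro i hi hi2
    have := (mem_J.1 (hs1 (i / 2) (by omega))).2
    have e : 1 + 2 * (i / 2) = i := by omega
    rw [e] at this; exact this.symm
  have huu : ∀ z, Out v p z → ¬ G.Adj u z := by
    intro z hz hadj
    have := hn z hadj hz
    rw [List.mem_singleton] at this
    exact hadj.ne this.symm
  -- even position to outside
  have c2 : ∀ i < p, i % 2 = 0 → ∀ z, Out v p z → ¬ G.Adj (v i) z := by
    intro i hi hi2 z hz hadj
    have hb := (Att.single hz hi hadj).bounds H
    simp only [List.length_singleton] at hb
    by_cases hzu : z = u
    · subst hzu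
      have h1 := hJsp i (mem_J.2 ⟨hi, hadj⟩) (i + 1) (mem_J.2 ⟨by omega, (hodd (i+1) (by omega) (by omega)).symm⟩)
      omega
    · have := H.mx _ (rot H (IsP.single z) hu (by simpa using fun h => hzu h.symm) (a := 1) (b := i + 1) (k := i + 1)
        (by omega) le_rfl (by omega) (by simpa using hz.seg le_rfl) (by simpa using hadj.symm)
        (hodd 1 (by omega) rfl) (fun h3 => hodd _ h3 (by omega)))
      simp only [List.length_append, length_seg, List.length_reverse, List.length_singleton] at this
      omega
  have c3 : ∀ x y, Out v p x → Out v p y → ¬ G.Adj x y := by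
    intro x y hx hy hxy
    obtain ⟨z, i, z', h1, h2, h3, h4, h5⟩ := exists_att_edge hconn (by omega) hx hy hxy
    have hi : i % 2 = 1 := by
      by_contra hne
      exact c2 i h2 (by omega) z h1 h3
    have hzu : u ≠ z := by rintro rfl; exact huu _ h4 h5
    have hzu' : u ≠ z' := by rintro rfl; exact huu _ h1 h5.symm
    have hR : IsP G [z', z] := by
      refine ⟨by simpa using h5.symm, by simpa using h5.ne'⟩
    have hb := (Att.single h1 h2 h3).bounds H
    simp only [List.length_singleton] at hb
    have := H.mx _ (rot H hR hu (by simpa using ⟨hzu', hzu⟩) (a := 1) (b := i + 1) (k := i + 2)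
        (by omega) (by omega) (by omega) (by simpa using ⟨h4.seg le_rfl, h1.seg le_rfl⟩) (by simpa using h3.symm)
        (hodd 1 (by omega) rfl) (fun h3 => hodd _ h3 (by omega)))
    simp only [List.length_append, length_seg, List.length_reverse, List.length_singleton, List.length_cons, List.length_nil] at this
    omega
  have c1 : ∀ i j, i < j → j < p → i % 2 = 0 → j % 2 = 0 → ¬ G.Adj (v i) (v j) := by
    intro i j hij hj hi2 hj2 hadj
    have hlast : ∀ x ∈ (seg v 0 (i + 1)).getLast?, G.Adj x (v (j + 1 - 1)) := by
      intro x hx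
      obtain ⟨_, rfl⟩ := last_seg hx
      simpa using hadj
    have := H.mx _ (rot H (H.seg (i := 0) (j := i + 1) (by omega)) hu (hu.seg (by omega)) (a := i + 1) (b := j + 1) (k := j + 1)
        (by omega) le_rfl (by omega) (H.disj le_rfl le_rfl) hlast
        (hodd _ (by omega) (by omega)) (fun h3 => hodd _ h3 (by omega)))
    simp only [List.length_append, length_seg, List.length_reverse, List.length_singleton] at this
    omega
  refine ⟨(Finset.range h).image (fun t => v (2 * t + 1)), ?_, ?_⟩
  · rw [Finset.card_image_of_injOn, Finset.card_range]
    intro x hx y hy hxy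
    simp only [Finset.coe_range, Set.mem_Iio] at hx hy
    have := H.inj _ (by omega) _ (by omega) hxy
    omega
  · have cls : ∀ x, x ∈ (Finset.range h).image (fun t => v (2 * t + 1)) ∨ Out v p x ∨
        ∃ i < p, i % 2 = 0 ∧ v i = x := by
      intro x
      by_cases hx : Out v p x
      · exact Or.inr (Or.inl hx)
      · unfold Out at hx; push Not at hx
        obtain ⟨i, hi, rfl⟩ := hx
        rcases Nat.mod_two_eq_zero_or_one i with h1 | h1
        · exact Or.inr (Or.inr ⟨i, hi, h1, rfl⟩)
        · left
          refine Finset.mem_image.2 ⟨i / 2, by rw [Finset.mem_range]; omega, ?_⟩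
          congr 1; omega
    intro a b hab
    rcases cls a with h1 | h1 | ⟨i, h1, h2, rfl⟩
    · exact Or.inl h1
    · rcases cls b with h3 | h3 | ⟨i, h3, h4, rfl⟩
      · exact Or.inr h3
      · exact absurd hab (c3 a b h1 h3)
      · exact absurd hab.symm (c2 i h3 h4 a h1)
    · rcases cls b with h3 | h3 | ⟨j, h3, h4, rfl⟩
      · exact Or.inr h3
      · exact absurd hab (c2 i h1 h2 b h3)
      · rcases lt_trichotomy i j with h5 | h5 | h5
        · exact absurd hab (c1 i j h5 h3 h2 h4)
        · subst h5; exact absurd hab (G.irrefl)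
        · exact absurd hab.symm (c1 j i h5 h1 h4 h2)

theorem lng_of_list {p : ℕ} (l : List V) (hl : IsP G l) (hlen : l.length = p)
    (hm : ∀ l : List V, IsP G l → l.length ≤ p) (d : V) : Lng G (fun i => l.getD i d) p := by
  have e : ∀ i (hi : i < p), l.getD i d = l[i]'(by omega) := by
    intro i hi; exact List.getD_eq_getElem _ _ _
  refine ⟨?_, ?_, hm⟩
  · intro i hi j hj hij
    try dsimp only at hij
    rw [e i hi, e j hj] at hij
    exact hl.2.getElem_inj_iff.1 hij
  · intro i hi
    rw [e i (by omega), e (i + 1) hi]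
    exact List.isChain_iff_getElem.1 hl.1 i (by omega)

theorem replace {v : ℕ → V} {p : ℕ} (H : Lng G v p) {Q j u w} (A : Att G v p Q j u w) {b : ℕ}
    (hb : b + Q.length ≤ p) (h1 : 0 < b → G.Adj (v (b - 1)) u)
    (h2 : b + Q.length < p → G.Adj w (v (b + Q.length))) :
    ∃ v', Lng G v' p ∧ (∀ t < p, t < b ∨ b + Q.length ≤ t → v' t = v t) ∧
      ∀ t, b ≤ t → t < b + Q.length → Out v' p (v t) := by
  have hl := ins H A.isP A.out A.hu A.hw (i := b) (j := b + Q.length) (k := p) (by omega) hb le_rfl h1 h2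
  have hlen : (seg v 0 b ++ (Q ++ seg v (b + Q.length) p)).length = p := by
    simp only [List.length_append, length_seg]; omega
  refine ⟨_, lng_of_list _ hl hlen H.mx u, ?_, ?_⟩
  · intro t ht htb
    rw [List.getD_eq_getElem _ _ (by omega)]
    rcases htb with htb | htb
    · rw [List.getElem_append_left (by rw [length_seg]; omega)]
      simp [seg]
    · rw [List.getElem_append_right (by rw [length_seg]; omega),
        List.getElem_append_right (by rw [length_seg]; omega)]
      simp only [seg, List.getElem_map, List.getElem_range', List.length_map, List.length_range']
      congr 1; omega
  · intro t ht1 ht2 i hi hit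
    try dsimp only at hit
    rw [List.getD_eq_getElem _ _ (by omega)] at hit
    have hm : v t ∈ seg v 0 b ++ (Q ++ seg v (b + Q.length) p) := by
      rw [← hit]; exact List.getElem_mem _
    rw [List.mem_append, List.mem_append, mem_seg, mem_seg] at hm
    rcases hm with ⟨t', q1, q2, q3⟩ | hm | ⟨t', q1, q2, q3⟩
    · have := H.inj _ (by omega) _ (by omega) q3; omega
    · exact A.out _ hm t (by omega) rfl
    · have := H.inj _ (by omega) _ (by omega) q3; omega

end cases
section struct
variable {V : Type*} {G : SimpleGraph V} [Fintype V] [DecidableEq V] [DecidableRel G.Adj]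

theorem L0 {v : ℕ → V} {p h : ℕ} (H : Lng G v p) (hp : p = 2 * h + 1)
    (hδ : ∀ x, h ≤ G.degree x) (hiso : ∀ x, Out v p x → ∃ y, Out v p y ∧ G.Adj x y)
    {j u} (hj : j < p) (hu : Out v p u) (ha : G.Adj (v j) u) :
    j = h ∧ ∃ Q w, Att G v p Q h u w ∧ Q.length = h := by
  obtain ⟨y, hy, huy⟩ := hiso u hu
  obtain ⟨Q, w, A, hlen, hn⟩ := ((Att.single hu hj ha).snoc hy (by simpa using huy.ne') huy).extend H p
    (by omega)
  simp at hlen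
  obtain ⟨hl, hJ1, -, ⟨s, hs, hs1, hs2⟩, -⟩ := core H (by omega) hδ A hn
  have hb := A.bounds H
  have hQ : Q.length = h := by
    by_contra hne
    have hsm : s = h + 1 - Q.length := by
      by_contra hne'
      have := hJ1 _ (hs2 (h - Q.length) (by omega) (by omega))
      omega
    subst hsm
    have sp : ∀ t < h + 1 - Q.length, Q.length + 2 * t = j ∨ Q.length + 2 * t + Q.length + 1 ≤ j ∨
        j + Q.length + 1 ≤ Q.length + 2 * t := by
      intro t ht
      have := mem_J.1 (hs1 t ht)
      exact A.space H this.1 this.2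
    have h1 := sp ((j - Q.length) / 2) (by omega)
    rcases Nat.eq_zero_or_pos ((j - Q.length) / 2) with h2 | h2
    · have h3 := sp 1 (by omega)
      omega
    · have h3 := sp ((j - Q.length) / 2 - 1) (by omega)
      omega
  have : j = h := by omega
  subst this
  exact ⟨rfl, Q, w, A, hQ⟩

theorem L1 {v : ℕ → V} {p h : ℕ} (H : Lng G v p) (hp : p = 2 * h + 1)
    (hδ : ∀ x, h ≤ G.degree x) {Q j u w} (A : Att G v p Q j u w) (hQ : Q.length = h) (z : V) :
    G.Adj w z ↔ z = v h ∨ (z ∈ Q ∧ z ≠ w) := by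
  have hn : NonExt G v p Q w := by
    intro z hz ho
    by_contra hc
    have := (A.snoc ho hc hz).bounds H
    simp at this; omega
  obtain ⟨hl, hJ1, -, ⟨s, hs, hs1, hs2⟩, hN⟩ := core H (by omega) hδ A hn
  have hh : h ∈ Jset G v p w := by
    rcases Nat.eq_zero_or_pos s with h0 | h0
    · have h1 := hs2 0 (by omega) (by omega)
      have := hJ1 _ h1; omega
    · have h1 := hs1 0 (by omega)
      rw [hQ] at h1; exact h1
  rw [hN z]
  constructor
  · rintro (⟨i, hi, rfl⟩ | h1)
    · have := hJ1 i hi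
      left; congr 1; omega
    · exact Or.inr h1
  · rintro (rfl | h1)
    · exact Or.inl ⟨h, hh, rfl⟩
    · exact Or.inr h1

theorem L2 {v : ℕ → V} {p h : ℕ} (H : Lng G v p) (hp : p = 2 * h + 1)
    (hδ : ∀ x, h ≤ G.degree x) {Q u w} (A : Att G v p Q h u w) (hQ : Q.length = h) (y : V)
    (hy : y ∈ Q) (z : V) :
    G.Adj y z ↔ z = v h ∨ (z ∈ Q ∧ z ≠ y) := by
  have hw := L1 H hp hδ A hQ
  obtain ⟨Q₁, Q₂, rfl⟩ := List.append_of_mem hy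
  have hlast : (y :: Q₂).getLast? = some w := by
    have := A.hw
    rw [List.getLast?_append] at this
    rcases hg : (y :: Q₂).getLast? with _ | r
    · simp at hg
    · rw [hg] at this; simpa using this
  have hnd := A.isP.2
  have hdis : ∀ x ∈ Q₁, x ∉ (y :: Q₂) := fun x hx hx' => (List.nodup_append.1 hnd).2.2 x hx x hx' rfl
  have hwm : w ∈ y :: Q₂ := List.mem_of_mem_getLast? hlast
  have hP : IsP G (Q₁ ++ (y :: Q₂).reverse) := by
    refine A.isP.left.append A.isP.right.reverse ?_ ?_
    · intro x hx; rw [List.mem_reverse]; exact hdis x hx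
    · intro x hx r hr
      rw [List.head?_reverse, hlast] at hr; cases hr
      have hx1 := List.mem_of_mem_getLast? hx
      exact ((hw x).2 (Or.inr ⟨List.mem_append_left _ hx1, fun h => hdis x hx1 (h ▸ hwm)⟩)).symm
  have hmem : ∀ x, x ∈ Q₁ ++ (y :: Q₂).reverse ↔ x ∈ Q₁ ++ y :: Q₂ := by
    intro x; simp only [List.mem_append, List.mem_reverse]
  have hhead : ∃ u', (Q₁ ++ (y :: Q₂).reverse).head? = some u' ∧ G.Adj (v h) u' := by
    rcases Q₁ with _ | ⟨q, Q₁⟩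
    · exact ⟨w, by rw [List.nil_append, List.head?_reverse]; exact hlast, ((hw (v h)).2 (Or.inl rfl)).symm⟩
    · refine ⟨u, ?_, A.adj⟩
      have := A.hu
      simpa using this
  obtain ⟨u', h1, h2⟩ := hhead
  have B : Att G v p (Q₁ ++ (y :: Q₂).reverse) h u' y :=
    ⟨hP, fun x hx => A.out x ((hmem x).1 hx), A.hj, h1, by simp, h2⟩
  have := L1 H hp hδ B (by rw [← hQ]; simp) z
  rw [hmem z] at this
  exact this

def Blk (G : SimpleGraph V) (c : V) (h : ℕ) (x : V) : Prop :=
  ∃ B : Finset V, x ∈ B ∧ c ∉ B ∧ B.card = h ∧ ∀ y ∈ B, ∀ z, G.Adj y z ↔ z = c ∨ (z ∈ B ∧ z ≠ y)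

theorem L3 (hconn : G.Connected) {v : ℕ → V} {p h : ℕ} (H : Lng G v p) (hp : p = 2 * h + 1)
    (hδ : ∀ x, h ≤ G.degree x) (hiso : ∀ x, Out v p x → ∃ y, Out v p y ∧ G.Adj x y)
    (x : V) (hx : Out v p x) : Blk G (v h) h x := by
  have hatt : ∀ u j, j < p → Out v p u → G.Adj (v j) u → Blk G (v h) h u := by
    intro u j hj hu ha
    obtain ⟨rfl, Q, w, A, hQ⟩ := L0 H hp hδ hiso hj hu ha
    refine ⟨Q.toFinset, List.mem_toFinset.2 A.memu, ?_, ?_, ?_⟩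
    · rw [List.mem_toFinset]; intro hc; exact A.out _ hc j hj rfl
    · rw [List.toFinset_card_of_nodup A.isP.2, hQ]
    · intro y hy z
      rw [List.mem_toFinset] at hy ⊢
      exact L2 H hp hδ A hQ y hy z
  have := conn_closed hconn {y | Out v p y → Blk G (v h) h y} (v 0) (fun h => absurd rfl (h 0 (by omega))) ?_ x
  · exact this hx
  · intro a ha b hab hb
    by_cases hoa : Out v p a
    · obtain ⟨B, h1, h2, h3, h4⟩ := ha hoa
      rcases (h4 a h1 b).1 hab with h5 | h5
      · exact absurd h5.symm (hb h (by omega))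
      · exact ⟨B, h5.1, h2, h3, h4⟩
    · unfold Out at hoa; push Not at hoa
      obtain ⟨i, hi, rfl⟩ := hoa
      exact hatt b i hi hb hab

theorem L4a (hconn : G.Connected) {p h : ℕ} (hp : p = 2 * h + 1)
    (hδ : ∀ x, h ≤ G.degree x)
    (hiso : ∀ v, Lng G v p → ∀ x, Out v p x → ∃ y, Out v p y ∧ G.Adj x y)
    {v : ℕ → V} (H : Lng G v p) (x0 : V) (hx0 : Out v p x0) (i : ℕ) (hi : i < h) :
    Blk G (v h) h (v i) := by
  obtain ⟨u, j, h1, h2, h3⟩ := exists_att hconn (by omega) hx0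
  obtain ⟨rfl, Q, w, A, hQ⟩ := L0 H hp hδ (hiso v H) h2 h1 h3
  obtain ⟨v', H', hv1, hv2⟩ := replace H A (b := 0) (by omega) (by omega)
    (fun _ => by rw [Nat.zero_add, hQ]; exact (L1 H hp hδ A hQ _).2 (Or.inl rfl))
  have e := hv1 j (by omega) (Or.inr (by omega))
  rw [← e]
  exact L3 hconn H' hp hδ (hiso v' H') _ (hv2 i (by omega) (by omega))

theorem L4 (hconn : G.Connected) {p h : ℕ} (hp : p = 2 * h + 1)
    (hδ : ∀ x, h ≤ G.degree x)
    (hiso : ∀ v, Lng G v p → ∀ x, Out v p x → ∃ y, Out v p y ∧ G.Adj x y)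
    {v : ℕ → V} (H : Lng G v p) (x0 : V) (hx0 : Out v p x0) (x : V) (hx : x ≠ v h) :
    Blk G (v h) h x := by
  by_cases ho : Out v p x
  · exact L3 hconn H hp hδ (hiso v H) x ho
  · unfold Out at ho; push Not at ho
    obtain ⟨i, hi, rfl⟩ := ho
    rcases lt_trichotomy i h with h1 | h1 | h1
    · exact L4a hconn hp hδ hiso H x0 hx0 i h1
    · subst h1; exact absurd rfl hx
    · have := L4a hconn hp hδ hiso H.rev x0 hx0.rev (p - 1 - i) (by omega)
      have e1 : p - 1 - (p - 1 - i) = i := by omega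
      have e2 : p - 1 - h = h := by omega
      simpa only [e1, e2] using this

theorem Ccomb {v : ℕ → V} {p h : ℕ} (H : Lng G v p) (hp : p = 2 * h + 2) (hδ : ∀ x, h ≤ G.degree x)
    {Q j u w} (A : Att G v p Q j u w) (hn : NonExt G v p Q w) (hn' : NonExt G v p Q.reverse u)
    (hl2 : 2 ≤ Q.length) (hlh : Q.length ≠ h) :
    h = 3 ∧ Q.length = 2 ∧ ∀ z, G.Adj w z ↔ (z = v 2 ∨ z = v 5) ∨ (z ∈ Q ∧ z ≠ w) := by
  obtain ⟨hl, hJ1, hJ2, ⟨s, hs, hs1, hs2⟩, hN⟩ := core H (by omega) hδ A hn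
  have hor : ∀ t < h + 1 - Q.length, Q.length + 2 * t ∈ Jset G v p w ∨ Q.length + 2 * t + 1 ∈ Jset G v p w := by
    intro t ht
    rcases Nat.lt_or_ge t s with h1 | h1
    · exact Or.inl (hs1 t h1)
    · exact Or.inr (hs2 t h1 ht)
  have hex : ∃ i, i < p ∧ G.Adj (v i) w := by
    rcases hor 0 (by omega) with h1 | h1
    · exact ⟨_, mem_J.1 h1⟩
    · exact ⟨_, mem_J.1 h1⟩
  obtain ⟨i, hi, hiw⟩ := hex
  obtain ⟨-, -, -, ⟨s', hs', hs1', hs2'⟩, -⟩ := core H (by omega) hδ (A.rev hi hiw) hn'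
  rw [List.length_reverse] at hs' hs1' hs2'
  have hor' : ∀ t < h + 1 - Q.length, Q.length + 2 * t ∈ Jset G v p u ∨ Q.length + 2 * t + 1 ∈ Jset G v p u := by
    intro t ht
    rcases Nat.lt_or_ge t s' with h1 | h1
    · exact Or.inl (hs1' t h1)
    · exact Or.inr (hs2' t h1 ht)
  have cross : ∀ a ∈ Jset G v p u, ∀ b ∈ Jset G v p w, b = a ∨ b + Q.length + 1 ≤ a ∨ a + Q.length + 1 ≤ b := by
    intro a ha b hb
    rw [mem_J] at ha hb
    have A' : Att G v p Q a u w := ⟨A.isP, A.out, ha.1, A.hu, A.hw, ha.2⟩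
    exact A'.space H hb.1 hb.2
  obtain ⟨x0, hx0, e0⟩ : ∃ x ∈ Jset G v p w, x = Q.length ∨ x = Q.length + 1 := by
    rcases hor 0 (by omega) with h1 | h1
    · exact ⟨_, h1, by omega⟩
    · exact ⟨_, h1, by omega⟩
  obtain ⟨x1, hx1, e1⟩ : ∃ x ∈ Jset G v p w, x = Q.length + 2 ∨ x = Q.length + 3 := by
    rcases hor 1 (by omega) with h1 | h1
    · exact ⟨_, h1, by omega⟩
    · exact ⟨_, h1, by omega⟩
  obtain ⟨y0, hy0, f0⟩ : ∃ x ∈ Jset G v p u, x = Q.length ∨ x = Q.length + 1 := by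
    rcases hor' 0 (by omega) with h1 | h1
    · exact ⟨_, h1, by omega⟩
    · exact ⟨_, h1, by omega⟩
  obtain ⟨y1, hy1, f1⟩ : ∃ x ∈ Jset G v p u, x = Q.length + 2 ∨ x = Q.length + 3 := by
    rcases hor' 1 (by omega) with h1 | h1
    · exact ⟨_, h1, by omega⟩
    · exact ⟨_, h1, by omega⟩
  have g00 := cross _ hy0 _ hx0
  have g01 := cross _ hy0 _ hx1
  have g10 := cross _ hy1 _ hx0
  have g11 := cross _ hy1 _ hx1
  have hx0' : x0 = 2 := by omega
  have hx1' : x1 = 5 := by omega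
  have hQ : Q.length = 2 := by omega
  subst hx0' hx1'
  have hh : h = 3 := by
    by_contra hne
    rcases hor 2 (by omega) with h1 | h1
    · have := cross _ hy1 _ h1; omega
    · have := cross _ hy1 _ h1; omega
  refine ⟨hh, hQ, fun z => ?_⟩
  rw [hN z]
  refine or_congr_left ⟨?_, ?_⟩
  · rintro ⟨i, hi, rfl⟩
    have b1 := hJ1 i hi
    have b2 := hJ2 2 hx0 i hi
    have b3 := hJ2 i hi 5 hx1
    have : i = 2 ∨ i = 5 := by omega
    rcases this with rfl | rfl
    · exact Or.inl rfl
    · exact Or.inr rfl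
  · rintro (rfl | rfl)
    · exact ⟨2, hx0, rfl⟩
    · exact ⟨5, hx1, rfl⟩

theorem iso_att {v : ℕ → V} {p h : ℕ} (hh : 1 ≤ h) (hδ : ∀ x, h ≤ G.degree x) {x : V} (hx : Out v p x)
    (hiso : ¬ ∃ y, Out v p y ∧ G.Adj x y) :
    NonExt G v p [x] x ∧ ∃ j, Att G v p [x] j x x := by
  push Not at hiso
  refine ⟨fun z hz ho => absurd hz (hiso z ho), ?_⟩
  have h1 : 0 < G.degree x := by have := hδ x; omega
  obtain ⟨y, hy⟩ := (G.degree_pos_iff_exists_adj x).1 h1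
  have : ¬ Out v p y := fun h => hiso y h hy
  unfold Out at this; push Not at this
  obtain ⟨i, hi, rfl⟩ := this
  exact ⟨i, Att.single hx hi hy.symm⟩

theorem C1 (hconn : G.Connected) {v : ℕ → V} {p h : ℕ} (H : Lng G v p) (hp : p = 2 * h + 2) (hh : 1 ≤ h)
    (hδ : ∀ x, h ≤ G.degree x) {a : ℕ} (ha1 : 1 ≤ a) (hah : a ≤ h)
    (hno : ¬ HasPair G (2 * a) (2 * h + 3 - 2 * a)) {x : V} (hx : Out v p x) :
    h = 3 ∧ ∀ Q j u w, Att G v p Q j u w → Q.length ≤ 2 := by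
  obtain ⟨u, j, h1, h2, h3⟩ := exists_att hconn (by omega) hx
  obtain ⟨Q, j', u', w', A, hm⟩ := Att.maxi H p (Att.single h1 h2 h3) (by omega)
  have hn := A.nonext_of_max hm
  obtain ⟨hl, hJ1, hJ2, ⟨s, hs, hs1, hs2⟩, hN⟩ := core H (by omega) hδ A hn
  have hpos := A.pos
  have hlh : Q.length ≠ h := fun h' => hno (caseB H hp A h' ha1 hah)
  have hl2 : 2 ≤ Q.length := by
    by_contra hlt
    have e1 : Q.length = 1 := by omega
    obtain ⟨q, rfl⟩ := List.length_eq_one_iff.1 e1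
    have hu := A.hu; have hw := A.hw
    simp at hu hw
    subst hu; subst hw
    exact hno (caseA H hp hδ A hn ha1 hah)
  have hex : ∃ i, i < p ∧ G.Adj (v i) w' := by
    rcases Nat.eq_zero_or_pos s with h0 | h0
    · exact ⟨_, mem_J.1 (hs2 0 (by omega) (by omega))⟩
    · exact ⟨_, mem_J.1 (hs1 0 (by omega))⟩
  obtain ⟨i, hi, hiw⟩ := hex
  have hn' := (A.rev hi hiw).nonext_of_max (fun Q₂ j₂ u₂ w₂ h => by
    rw [List.length_reverse]; exact hm Q₂ j₂ u₂ w₂ h)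
  obtain ⟨e1, e2, -⟩ := Ccomb H hp hδ A hn hn' hl2 hlh
  exact ⟨e1, fun Q₂ j₂ u₂ w₂ h => by have := hm Q₂ j₂ u₂ w₂ h; omega⟩

def Mat (G : SimpleGraph V) (c c' x y : V) : Prop :=
  y ≠ x ∧ y ≠ c ∧ y ≠ c' ∧ x ≠ c ∧ x ≠ c' ∧ (∀ z, G.Adj x z ↔ (z = c ∨ z = c') ∨ z = y) ∧
    ∀ z, G.Adj y z ↔ (z = c ∨ z = c') ∨ z = x

theorem C2a (hconn : G.Connected) {v : ℕ → V} {p h : ℕ} (H : Lng G v p) (hp : p = 2 * h + 2) (hh : 1 ≤ h)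
    (hδ : ∀ x, h ≤ G.degree x) {a : ℕ} (ha1 : 1 ≤ a) (hah : a ≤ h)
    (hno : ¬ HasPair G (2 * a) (2 * h + 3 - 2 * a)) {u : V} {j : ℕ} (hu : Out v p u) (hj : j < p)
    (hadj : G.Adj (v j) u) : ∃ w, Att G v p [u, w] j u w ∧ Mat G (v 2) (v 5) u w := by
  obtain ⟨h3, hmax⟩ := C1 hconn H hp hh hδ ha1 hah hno hu
  by_cases hiso : ∃ y, Out v p y ∧ G.Adj u y
  · obtain ⟨w, hw, huw⟩ := hiso
    have A : Att G v p [u, w] j u w := (Att.single hu hj hadj).snoc hw (by simpa using huw.ne') huw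
    have hm : ∀ Q₂ j₂ u₂ w₂, Att G v p Q₂ j₂ u₂ w₂ → Q₂.length ≤ [u, w].length := by
      intro Q₂ j₂ u₂ w₂ h; exact hmax Q₂ j₂ u₂ w₂ h
    have hn := A.nonext_of_max hm
    obtain ⟨hl, hJ1, hJ2, ⟨s, hs, hs1, hs2⟩, hN⟩ := core H (by omega) hδ A hn
    have hlen : [u, w].length = 2 := rfl
    have hex : ∃ i, i < p ∧ G.Adj (v i) w := by
      rcases Nat.eq_zero_or_pos s with h0 | h0
      · exact ⟨_, mem_J.1 (hs2 0 (by omega) (by omega))⟩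
      · exact ⟨_, mem_J.1 (hs1 0 (by omega))⟩
    obtain ⟨i, hi, hiw⟩ := hex
    have A' := A.rev hi hiw
    have hn' := A'.nonext_of_max hm
    obtain ⟨-, -, hNw⟩ := Ccomb H hp hδ A hn hn' (by omega) (by omega)
    obtain ⟨-, -, hNu⟩ := Ccomb H hp hδ A' hn' hn (by simp) (by simp; omega)
    refine ⟨w, A, huw.ne', (hw 2 (by omega)).symm, (hw 5 (by omega)).symm, (hu 2 (by omega)).symm,
      (hu 5 (by omega)).symm, fun z => ?_, fun z => ?_⟩
    · rw [hNu z]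
      refine or_congr_right ⟨?_, ?_⟩
      · rintro ⟨h1, h2⟩; simp at h1; tauto
      · rintro rfl; exact ⟨by simp, huw.ne'⟩
    · rw [hNw z]
      refine or_congr_right ⟨?_, ?_⟩
      · rintro ⟨h1, h2⟩; simp at h1; tauto
      · rintro rfl; exact ⟨by simp, huw.ne⟩
  · obtain ⟨hn, j', A⟩ := iso_att hh hδ hu hiso
    exact absurd (caseA H hp hδ A hn ha1 hah) hno

theorem C2 (hconn : G.Connected) {v : ℕ → V} {p h : ℕ} (H : Lng G v p) (hp : p = 2 * h + 2) (hh : 1 ≤ h)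
    (hδ : ∀ x, h ≤ G.degree x) {a : ℕ} (ha1 : 1 ≤ a) (hah : a ≤ h)
    (hno : ¬ HasPair G (2 * a) (2 * h + 3 - 2 * a)) {x : V} (hx : Out v p x) :
    ∃ y, Mat G (v 2) (v 5) x y := by
  obtain ⟨h3, -⟩ := C1 hconn H hp hh hδ ha1 hah hno hx
  have := conn_closed hconn {x | Out v p x → ∃ y, Mat G (v 2) (v 5) x y} (v 0)
    (fun h => absurd rfl (h 0 (by omega))) ?_ x
  · exact this hx
  · intro b hb d hbd hd
    by_cases ho : Out v p b
    · obtain ⟨y, m1, m2, m3, m4, m5, m6, m7⟩ := hb ho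
      rcases (m6 d).1 hbd with (h1 | h1) | h1
      · exact absurd h1.symm (hd 2 (by omega))
      · exact absurd h1.symm (hd 5 (by omega))
      · subst h1
        exact ⟨b, m1.symm, m4, m5, m2, m3, m7, m6⟩
    · unfold Out at ho; push Not at ho
      obtain ⟨i, hi, rfl⟩ := ho
      obtain ⟨w, -, hw⟩ := C2a hconn H hp hh hδ ha1 hah hno hd hi hbd
      exact ⟨w, hw⟩

theorem C3 (hconn : G.Connected) {v : ℕ → V} {p h : ℕ} (H : Lng G v p) (hp : p = 2 * h + 2) (hh : 1 ≤ h)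
    (hδ : ∀ x, h ≤ G.degree x) {a : ℕ} (ha1 : 1 ≤ a) (hah : a ≤ h)
    (hno : ¬ HasPair G (2 * a) (2 * h + 3 - 2 * a)) {x0 : V} (hx0 : Out v p x0) :
    h = 3 ∧ HasPair G 5 5 ∧ HasPair G 8 2 ∧
      ∀ x, x ≠ v 2 → x ≠ v 5 → ∃ y, Mat G (v 2) (v 5) x y := by
  obtain ⟨h3, -⟩ := C1 hconn H hp hh hδ ha1 hah hno hx0
  obtain ⟨u, j, q1, q2, q3⟩ := exists_att hconn (by omega) hx0
  obtain ⟨w, A, M⟩ := C2a hconn H hp hh hδ ha1 hah hno q1 q2 q3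
  obtain ⟨m1, m2, m3, m4, m5, m6, m7⟩ := M
  have A2 : Att G v p [u, w] 2 u w := ⟨A.isP, A.out, by omega, A.hu, A.hw, ((m6 _).2 (by simp)).symm⟩
  have hlen : [u, w].length = 2 := rfl
  refine ⟨h3, (A2.pair1 H).mono (by omega) (by omega), (A2.pair2 H).mono (by omega) (by omega), ?_⟩
  have key : ∀ b, (b = 0 ∨ b = 3 ∨ b = 6) → ∀ t, b ≤ t → t < b + 2 → ∃ y, Mat G (v 2) (v 5) (v t) y := by
    intro b hb t ht1 ht2
    obtain ⟨v', H', hv1, hv2⟩ := replace H A (b := b) (by omega)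
      (fun h0 => by
        rcases hb with rfl | rfl | rfl
        · omega
        · exact ((m6 _).2 (by simp)).symm
        · exact ((m6 _).2 (by simp)).symm)
      (fun h0 => by
        rcases hb with rfl | rfl | rfl
        · exact (m7 _).2 (by simp)
        · exact (m7 _).2 (by simp)
        · omega)
    have e2 := hv1 2 (by omega) (by omega)
    have e5 := hv1 5 (by omega) (by omega)
    rw [← e2, ← e5]
    exact C2 hconn H' hp hh hδ ha1 hah hno (hv2 t ht1 (by omega))
  intro x hx2 hx5
  by_cases ho : Out v p x
  · exact C2 hconn H hp hh hδ ha1 hah hno ho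
  · unfold Out at ho; push Not at ho
    obtain ⟨i, hi, rfl⟩ := ho
    have : i ≠ 2 := by rintro rfl; exact hx2 rfl
    have : i ≠ 5 := by rintro rfl; exact hx5 rfl
    rcases (by omega : i < 2 ∨ (3 ≤ i ∧ i < 5) ∨ 6 ≤ i) with h1 | h1 | h1
    · exact key 0 (by simp) i (by omega) (by omega)
    · exact key 3 (by simp) i (by omega) (by omega)
    · exact key 6 (by simp) i (by omega) (by omega)

end struct

section emb
variable {V : Type*} {G : SimpleGraph V} [Fintype V] [DecidableEq V]

theorem idx_inj {α : Type*} [DecidableEq α] (l : List α) {x y : α} (hx : x ∈ l) (_hy : y ∈ l)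
    (h : l.idxOf x = l.idxOf y) : x = y := (List.idxOf_inj hx).1 h

theorem partition_lem (Y : Finset V) (q : ℕ) (B : V → Finset V) (h1 : ∀ x ∈ Y, x ∈ B x)
    (h2 : ∀ x ∈ Y, B x ⊆ Y) (h3 : ∀ x ∈ Y, (B x).card = q)
    (h4 : ∀ x ∈ Y, ∀ y ∈ B x, B y = B x) :
    ∃ t, Y.card = t * q ∧ ∃ f g : V → ℕ, (∀ x ∈ Y, f x < t ∧ g x < q) ∧
      (∀ x ∈ Y, ∀ y ∈ Y, f x = f y ↔ B x = B y) ∧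
      (∀ x ∈ Y, ∀ y ∈ Y, f x = f y → g x = g y → x = y) := by
  have hC : ∀ x ∈ Y, B x ∈ (Y.image B).toList := fun x hx =>
    Finset.mem_toList.2 (Finset.mem_image_of_mem B hx)
  have hf : ∀ x ∈ Y, ∀ y ∈ Y,
      (Y.image B).toList.idxOf (B x) = (Y.image B).toList.idxOf (B y) ↔ B x = B y := by
    intro x hx y hy
    exact ⟨fun h => idx_inj _ (hC x hx) (hC y hy) h, fun h => by rw [h]⟩
  refine ⟨(Y.image B).card, ?_, fun x => (Y.image B).toList.idxOf (B x),
    fun x => (B x).toList.idxOf x, ?_, hf, ?_⟩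
  · rw [Finset.card_eq_sum_card_image B Y, Finset.sum_const_nat (m := q)]
    intro b hb
    obtain ⟨x, hx, rfl⟩ := Finset.mem_image.1 hb
    rw [← h3 x hx]
    congr 1
    ext y
    simp only [Finset.mem_filter]
    exact ⟨fun ⟨h, e⟩ => e ▸ h1 y h, fun h => ⟨h2 x hx h, h4 x hx y h⟩⟩
  · intro x hx
    refine ⟨?_, ?_⟩
    · have := List.idxOf_lt_length_of_mem (hC x hx)
      rwa [Finset.length_toList] at this
    · have := List.idxOf_lt_length_of_mem (Finset.mem_toList.2 (h1 x hx))
      rw [Finset.length_toList, h3 x hx] at this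
      exact this
  · intro x hx y hy h h'
    have e := (hf x hx y hy).1 h
    dsimp only at h'
    rw [← e] at h'
    exact idx_inj _ (Finset.mem_toList.2 (h1 x hx)) (Finset.mem_toList.2 (e ▸ h1 y hy)) h'

theorem emb_S {h : ℕ} (X : Finset V) (hX : X.card = h)
    (hc : ∀ a b, G.Adj a b → a ∈ X ∨ b ∈ X) : SubgraphOf G (Sgraph (Fintype.card V) h) := by
  have hlt : ∀ x, (X.toList ++ Xᶜ.toList).idxOf x < Fintype.card V := by
    intro x
    have := List.idxOf_lt_length_of_mem (a := x) (l := X.toList ++ Xᶜ.toList) (by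
      rw [List.mem_append, Finset.mem_toList, Finset.mem_toList, Finset.mem_compl]; tauto)
    rwa [List.length_append, Finset.length_toList, Finset.length_toList,
      Finset.card_add_card_compl] at this
  have hin : ∀ x ∈ X, (X.toList ++ Xᶜ.toList).idxOf x < h := by
    intro x hx
    rw [List.idxOf_append_of_mem (Finset.mem_toList.2 hx), ← hX, ← Finset.length_toList]
    exact List.idxOf_lt_length_of_mem (Finset.mem_toList.2 hx)
  have hm : ∀ x, x ∈ X.toList ++ Xᶜ.toList := by
    intro x
    rw [List.mem_append, Finset.mem_toList, Finset.mem_toList, Finset.mem_compl]; tauto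
  have hi : Function.Injective
      (fun x => (⟨(X.toList ++ Xᶜ.toList).idxOf x, hlt x⟩ : Fin (Fintype.card V))) := by
    intro x y hxy
    exact idx_inj _ (hm x) (hm y) (Fin.mk.inj hxy)
  refine ⟨⟨_, hi⟩, ?_⟩
  intro a b hab
  unfold Sgraph
  rw [SimpleGraph.fromRel_adj]
  refine ⟨fun e => hab.ne (hi e), ?_⟩
  rcases hc a b hab with h' | h'
  · exact Or.inl (hin a h')
  · exact Or.inr (hin b h')

theorem div_aux {q i r : ℕ} (hr : r < q) : (r + q * i) / q = i := by
  rw [Nat.add_mul_div_left _ _ (by omega), Nat.div_eq_of_lt hr, zero_add]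

theorem lt_aux {q i r t : ℕ} (hr : r < q) (hi : i < t) : r + q * i < t * q := by
  have : (i + 1) * q ≤ t * q := Nat.mul_le_mul_right q hi
  nlinarith

theorem emb_L {h : ℕ} {c : V} (hB : ∀ x, x ≠ c → Blk G c h x) :
    ∃ t, Fintype.card V = t * h + 1 ∧ Nonempty (G ≃g Lgen t 0 h) := by
  classical
  have key : ∀ x, ∃ B : Finset V, x ≠ c → (x ∈ B ∧ c ∉ B ∧ B.card = h ∧
      ∀ y ∈ B, ∀ z, G.Adj y z ↔ z = c ∨ (z ∈ B ∧ z ≠ y)) := by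
    intro x
    by_cases hx : x = c
    · exact ⟨∅, fun h => (h hx).elim⟩
    · obtain ⟨B, hB⟩ := hB x hx
      exact ⟨B, fun _ => hB⟩
  choose B hB using key
  have hB1 : ∀ x, x ≠ c → ∀ z, z ∈ B x ↔ (z ≠ c ∧ (G.Adj x z ∨ z = x)) := by
    intro x hx z
    obtain ⟨h1, h2, h3, h4⟩ := hB x hx
    rw [h4 x h1]
    by_cases hz : z = c
    · subst hz; simp [h2]
    · by_cases hzx : z = x
      · subst hzx; simp [h1, hz]
      · simp [hz, hzx]
  obtain ⟨t, ht, f, g, hfg, hf, hinj⟩ := partition_lem (Finset.univ.erase c) h B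
    (fun x hx => (hB x (Finset.ne_of_mem_erase hx)).1)
    (fun x hx y hy => by
      have := (hB x (Finset.ne_of_mem_erase hx)).2.1
      simp only [Finset.mem_erase, Finset.mem_univ, and_true]
      rintro rfl; exact this hy)
    (fun x hx => (hB x (Finset.ne_of_mem_erase hx)).2.2.1)
    (fun x hx y hy => by
      obtain ⟨h1, h2, h3, h4⟩ := hB x (Finset.ne_of_mem_erase hx)
      have hyc : y ≠ c := by rintro rfl; exact h2 hy
      ext z
      rw [hB1 y hyc, h4 y hy z]
      by_cases hz : z = c
      · subst hz; simp [h2]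
      · by_cases hzx : z = y
        · subst hzx; simp [hy, hz]
        · simp [hz, hzx])
  have hcard : Fintype.card V = t * h + 1 := by
    rw [Finset.card_erase_of_mem (Finset.mem_univ c), Finset.card_univ] at ht
    have : 0 < Fintype.card V := Fintype.card_pos_iff.2 ⟨c⟩
    omega
  refine ⟨t, hcard, ?_⟩
  have hY : ∀ x, x ≠ c → x ∈ Finset.univ.erase c := fun x hx => by simp [hx]
  let φ : V → ℕ := fun x => if x = c then 0 else 1 + (g x + h * f x)
  have φc : φ c = 0 := by simp [φ]
  have φx : ∀ x, x ≠ c → φ x = 1 + (g x + h * f x) := fun x hx => by simp [φ, hx]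
  have φlt : ∀ x, φ x < t * h + 0 * (h + 1) + 1 := by
    intro x
    by_cases hx : x = c
    · rw [hx, φc]; omega
    · rw [φx x hx]
      have := lt_aux (hfg x (hY x hx)).2 (hfg x (hY x hx)).1
      omega
  have φb : ∀ x, x ≠ c → blockIdx t h (φ x) = f x := by
    intro x hx
    have := lt_aux (hfg x (hY x hx)).2 (hfg x (hY x hx)).1
    rw [φx x hx]
    unfold blockIdx
    rw [if_pos (by omega), Nat.add_sub_cancel_left, div_aux (hfg x (hY x hx)).2]
  have φi : ∀ x y, φ x = φ y → x = y := by
    intro x y hxy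
    by_cases hx : x = c
    · by_cases hy : y = c
      · rw [hx, hy]
      · rw [hx, φc, φx y hy] at hxy; omega
    · by_cases hy : y = c
      · rw [hy, φc, φx x hx] at hxy; omega
      · have e : f x = f y := by rw [← φb x hx, ← φb y hy, hxy]
        rw [φx x hx, φx y hy, e] at hxy
        exact hinj x (hY x hx) y (hY y hy) e (by omega)
  have hi : Function.Injective (fun x => (⟨φ x, φlt x⟩ : Fin (t * h + 0 * (h + 1) + 1))) := by
    intro x y hxy
    exact φi x y (Fin.mk.inj hxy)
  have hbij := (Fintype.bijective_iff_injective_and_card _).2 ⟨hi, by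
    rw [Fintype.card_fin, hcard]; omega⟩
  have hcadj : ∀ y, y ≠ c → G.Adj c y := by
    intro y hy
    obtain ⟨h1, h2, h3, h4⟩ := hB y hy
    exact ((h4 y h1 c).2 (Or.inl rfl)).symm
  refine ⟨⟨Equiv.ofBijective _ hbij, ?_⟩⟩
  intro x y
  simp only [Equiv.ofBijective_apply]
  unfold Lgen
  rw [SimpleGraph.fromRel_adj]
  by_cases hxy : x = y
  · subst hxy; simp
  have hne : (⟨φ x, φlt x⟩ : Fin (t * h + 0 * (h + 1) + 1)) ≠ ⟨φ y, φlt y⟩ := fun e => hxy (hi e)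
  by_cases hx : x = c
  · subst hx
    exact ⟨fun _ => hcadj y (Ne.symm hxy), fun _ => ⟨hne, Or.inl (Or.inl φc)⟩⟩
  by_cases hy : y = c
  · subst hy
    exact ⟨fun _ => (hcadj x hxy).symm, fun _ => ⟨hne, Or.inr (Or.inl φc)⟩⟩
  dsimp only
  rw [φb x hx, φb y hy]
  have e1 : φ x ≠ 0 := by rw [φx x hx]; omega
  have e2 : φ y ≠ 0 := by rw [φx y hy]; omega
  have e3 : f x = f y ↔ G.Adj x y := by
    rw [hf x (hY x hx) y (hY y hy)]
    constructor
    · intro e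
      have : y ∈ B x := e ▸ (hB y hy).1
      rcases ((hB1 x hx y).1 this).2 with h | h
      · exact h
      · exact (hxy h.symm).elim
    · intro hadj
      have hyB : y ∈ B x := (hB1 x hx y).2 ⟨hy, Or.inl hadj⟩
      obtain ⟨h1, h2, h3, h4⟩ := hB x hx
      ext z
      rw [hB1 y hy, h4 y hyB z]
      by_cases hz : z = c
      · subst hz; simp [h2]
      · by_cases hzx : z = y
        · subst hzx; simp [hyB, hz]
        · simp [hz, hzx]
  rw [← e3]
  constructor
  · rintro ⟨_, (h | h) | (h | h)⟩
    · exact (e1 h).elim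
    · exact h
    · exact (e2 h).elim
    · exact h.symm
  · exact fun h => ⟨hne, Or.inl (Or.inr h)⟩

theorem emb_K {c c' : V} (hcc : c ≠ c') (hM : ∀ x, x ≠ c → x ≠ c' → ∃ y, Mat G c c' x y) :
    ∃ m, Fintype.card V = 2 + 2 * m ∧ SubgraphOf G (KjoinMK2 2 m) := by
  classical
  have key : ∀ x, ∃ y, x ≠ c → x ≠ c' → Mat G c c' x y := by
    intro x
    by_cases hx : x ≠ c ∧ x ≠ c'
    · obtain ⟨y, hy⟩ := hM x hx.1 hx.2
      exact ⟨y, fun _ _ => hy⟩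
    · exact ⟨x, fun h h' => (hx ⟨h, h'⟩).elim⟩
  choose m hm using key
  have hY : ∀ x, x ∈ (Finset.univ.erase c).erase c' ↔ x ≠ c ∧ x ≠ c' := by
    intro x; simp [and_comm]
  have huniq : ∀ x y, Mat G c c' x y → m x = y ∧ m y = x := by
    intro x y hxy
    obtain ⟨a1, a2, a3, a4, a5, a6, a7⟩ := hxy
    obtain ⟨b1, b2, b3, b4, b5, b6, b7⟩ := hm x a4 a5
    obtain ⟨d1, d2, d3, d4, d5, d6, d7⟩ := hm y a2 a3
    have e1 := (a6 (m x)).1 ((b6 (m x)).2 (Or.inr rfl))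
    have e2 := (a7 (m y)).1 ((d6 (m y)).2 (Or.inr rfl))
    tauto
  obtain ⟨t, ht, f, g, hfg, hf, hinj⟩ := partition_lem ((Finset.univ.erase c).erase c') 2
    (fun x => {x, m x})
    (fun x hx => by simp)
    (fun x hx y hy => by
      rw [hY] at hx ⊢
      obtain ⟨a1, a2, a3, a4, a5, a6, a7⟩ := hm x hx.1 hx.2
      simp only [Finset.mem_insert, Finset.mem_singleton] at hy
      rcases hy with rfl | rfl
      · exact hx
      · exact ⟨a2, a3⟩)
    (fun x hx => by
      rw [hY] at hx
      exact Finset.card_pair (hm x hx.1 hx.2).1.symm)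
    (fun x hx y hy => by
      rw [hY] at hx
      have := huniq x _ (hm x hx.1 hx.2)
      simp only [Finset.mem_insert, Finset.mem_singleton] at hy
      rcases hy with rfl | rfl
      · rfl
      · rw [this.2, Finset.pair_comm])
  have hcard : Fintype.card V = 2 + 2 * t := by
    rw [Finset.card_erase_of_mem (by simp [hcc.symm]), Finset.card_erase_of_mem (Finset.mem_univ c),
      Finset.card_univ] at ht
    have : 1 < Fintype.card V := Fintype.one_lt_card_iff.2 ⟨c, c', hcc⟩
    omega
  refine ⟨t, hcard, ?_⟩
  let φ : V → ℕ := fun x => if x = c then 0 else if x = c' then 1 else 2 + (g x + 2 * f x)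
  have φc : φ c = 0 := by simp [φ]
  have φc' : φ c' = 1 := by simp [φ, hcc.symm]
  have φx : ∀ x, x ≠ c → x ≠ c' → φ x = 2 + (g x + 2 * f x) := fun x hx hx' => by simp [φ, hx, hx']
  have φf : ∀ x, x ≠ c → x ≠ c' → f x < t ∧ g x < 2 := fun x hx hx' => hfg x ((hY x).2 ⟨hx, hx'⟩)
  have φlt : ∀ x, φ x < 2 + 2 * t := by
    intro x
    by_cases hx : x = c
    · rw [hx, φc]; omega
    by_cases hx' : x = c'
    · rw [hx', φc']; omega
    · rw [φx x hx hx']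
      have := φf x hx hx'
      omega
  have φi : ∀ x y, φ x = φ y → x = y := by
    intro x y hxy
    by_cases hx : x = c
    · by_cases hy : y = c
      · rw [hx, hy]
      by_cases hy' : y = c'
      · rw [hx, hy', φc, φc'] at hxy; omega
      · rw [hx, φc, φx y hy hy'] at hxy; omega
    by_cases hx' : x = c'
    · by_cases hy : y = c
      · rw [hx', hy, φc, φc'] at hxy; omega
      by_cases hy' : y = c'
      · rw [hx', hy']
      · rw [hx', φc', φx y hy hy'] at hxy; omega
    by_cases hy : y = c
    · rw [hy, φc, φx x hx hx'] at hxy; omega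
    by_cases hy' : y = c'
    · rw [hy', φc', φx x hx hx'] at hxy; omega
    rw [φx x hx hx', φx y hy hy'] at hxy
    have h1 := φf x hx hx'
    have h2 := φf y hy hy'
    exact hinj x ((hY x).2 ⟨hx, hx'⟩) y ((hY y).2 ⟨hy, hy'⟩) (by omega) (by omega)
  have hi : Function.Injective (fun x => (⟨φ x, φlt x⟩ : Fin (2 + 2 * t))) := by
    intro x y hxy
    exact φi x y (Fin.mk.inj hxy)
  refine ⟨⟨_, hi⟩, ?_⟩
  intro x y hxy
  unfold KjoinMK2
  rw [SimpleGraph.fromRel_adj]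
  refine ⟨fun e => hxy.ne (hi e), ?_⟩
  change (φ x < 2 ∨ (φ x - 2) / 2 = (φ y - 2) / 2) ∨ (φ y < 2 ∨ (φ y - 2) / 2 = (φ x - 2) / 2)
  by_cases hx : x = c
  · left; left; rw [hx, φc]; omega
  by_cases hx' : x = c'
  · left; left; rw [hx', φc']; omega
  by_cases hy : y = c
  · right; left; rw [hy, φc]; omega
  by_cases hy' : y = c'
  · right; left; rw [hy', φc']; omega
  left; right
  have h1 := φf x hx hx'
  have h2 := φf y hy hy'
  have hmx := hm x hx hx'
  have hu := huniq x _ hmx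
  have hym : y = m x := by
    rcases (hmx.2.2.2.2.2.1 y).1 hxy with (h | h) | h
    · exact (hy h).elim
    · exact (hy' h).elim
    · exact h
  have e : f x = f y := by
    refine (hf x ((hY x).2 ⟨hx, hx'⟩) y ((hY y).2 ⟨hy, hy'⟩)).2 ?_
    rw [hym, hu.2, Finset.pair_comm]
  rw [φx x hx hx', φx y hy hy']
  omega

end emb
theorem stmt_18 {V : Type*} [Fintype V] [DecidableEq V] (G : SimpleGraph V)
    [DecidableRel G.Adj] (h k : ℕ) (hh : 1 ≤ h) (hk : 1 ≤ k)
    (a : Fin k → ℕ) (ha : Antitone a) (ha1 : ∀ i, 1 ≤ a i)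
    (b₁ : ℕ) (hb1 : 1 ≤ b₁)
    (hsum : (∑ i, a i) + b₁ = h + 1)
    (hconn : G.Connected) (hcard : 2 * h + 3 ≤ Fintype.card V)
    (hδ : ∀ v, h ≤ G.degree v) :
    ContainsForest G (Sum.elim (fun i : Fin k => 2 * a i) (fun _ : Fin 1 => 2 * b₁ + 1)) ∨
    SubgraphOf G (Sgraph (Fintype.card V) h) ∨
    (k = 1 ∧ (∀ i, a i = 3) ∧ b₁ = 1 ∧
      ∃ m, Fintype.card V = 2 + 2 * m ∧ SubgraphOf G (KjoinMK2 2 m)) ∨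
    (k = 1 ∧ ((∀ i, a i = b₁) ∨ (∀ i, a i = b₁ + 1)) ∧
      ∃ t, Fintype.card V = t * h + 1 ∧ Nonempty (G ≃g Lgen t 0 h)) := by
  classical
  by_cases hF : ContainsForest G (Sum.elim (fun i : Fin k => 2 * a i) (fun _ : Fin 1 => 2 * b₁ + 1))
  · exact Or.inl hF
  right
  have hkA : k ≤ ∑ i, a i := by
    have := Finset.sum_le_sum (s := Finset.univ) (fun i _ => ha1 i)
    simpa using this
  -- a longest path
  obtain ⟨l, hl, hmax⟩ : ∃ l : List V, IsP G l ∧ ∀ l', IsP G l' → l'.length ≤ l.length := by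
    have hex : ∃ n, ∃ l : List V, IsP G l ∧ l.length = n := ⟨0, [], IsP.nil, rfl⟩
    have hbd : ∀ n, (∃ l : List V, IsP G l ∧ l.length = n) → n ≤ Fintype.card V := by
      rintro n ⟨l, hl, rfl⟩
      exact hl.2.length_le_card
    obtain ⟨l, hl, hl'⟩ := Nat.findGreatest_spec (P := fun n => ∃ l : List V, IsP G l ∧ l.length = n)
      (Nat.zero_le (Fintype.card V)) ⟨[], IsP.nil, rfl⟩
    refine ⟨l, hl, fun l' h' => ?_⟩
    rw [hl']
    exact Nat.le_findGreatest (hbd _ ⟨l', h', rfl⟩) ⟨l', h', rfl⟩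
  obtain ⟨p, hp⟩ : ∃ p, l.length = p := ⟨_, rfl⟩
  have hple : p ≤ 2 * h + 2 := by
    by_contra hcon
    apply hF
    apply pair_sum
    refine ⟨l.take (2 * ∑ i, a i), l.drop (2 * ∑ i, a i), hl.take _, hl.drop _, hl.take_drop _, ?_, ?_⟩
    · rw [List.length_take]; omega
    · rw [List.length_drop]; omega
  obtain ⟨d⟩ : Nonempty V := hconn.nonempty
  have hp0 : 0 < p := by
    have := hmax [d] (IsP.single d)
    simp at this; omega
  have H := lng_of_list l hl hp (by rw [← hp]; exact hmax) d
  obtain ⟨v, hv⟩ : ∃ v : ℕ → V, v = fun i => l.getD i d := ⟨_, rfl⟩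
  rw [← hv] at H
  obtain ⟨x0, hx0⟩ : ∃ x, Out v p x := by
    by_contra hcon
    have hcov : (Finset.univ : Finset V) ⊆ (Finset.range p).image v := by
      intro x _
      by_contra hx
      apply hcon
      refine ⟨x, fun i hi e => hx ?_⟩
      exact Finset.mem_image.2 ⟨i, Finset.mem_range.2 hi, e⟩
    have h1 := Finset.card_le_card hcov
    have h2 := Finset.card_image_le (s := Finset.range p) (f := v)
    rw [Finset.card_range] at h2
    rw [Finset.card_univ] at h1
    omega
  have hge := p_ge hconn H hp0 hple hδ hx0
  rcases (by omega : p = 2 * h + 1 ∨ p = 2 * h + 2) with hp1 | hp2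
  · by_cases hiso : ∀ v : ℕ → V, Lng G v p → ∀ x, Out v p x → ∃ y, Out v p y ∧ G.Adj x y
    · right; right
      have hL := L4 hconn hp1 hδ hiso H x0 hx0
      obtain ⟨u, j, hu, hj, hadj⟩ := exists_att hconn hp0 hx0
      obtain ⟨-, Q, w, A, hQ⟩ := L0 H hp1 hδ (hiso v H) hj hu hadj
      have hpair : HasPair G (2 * h + 1) h := by
        refine ⟨seg v 0 p, Q, H.seg le_rfl, A.isP, ?_, ?_, ?_⟩
        · intro x hx hx'
          exact (A.out x hx').seg le_rfl hx
        · rw [length_seg]; omega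
        · omega
      have hai : ∀ i, h + 1 ≤ 2 * a i := by
        intro i
        by_contra hcon
        have := ha1 i
        exact hF (pair_one a b₁ h hsum i (hpair.symm.mono (by omega) (by omega)))
      have hbi : h + 1 ≤ 2 * b₁ + 1 := by
        by_contra hcon
        exact hF (pair_sum a b₁ (hpair.mono (by omega) (by omega)))
      have hs : k * (h + 1) ≤ 2 * ∑ i, a i := by
        have := Finset.sum_le_sum (s := Finset.univ) (fun i _ => hai i)
        rw [← Finset.mul_sum] at this
        simpa using this
      have hk1 : k = 1 := by
        by_contra hcon
        have : 2 * (h + 1) ≤ k * (h + 1) := Nat.mul_le_mul_right _ (by omega)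
        omega
      subst hk1
      refine ⟨rfl, ?_, emb_L hL⟩
      have h0 := hai 0
      rw [Fin.sum_univ_one] at hsum
      rcases (by omega : a 0 = b₁ ∨ a 0 = b₁ + 1) with e | e
      · left; intro i; rw [Subsingleton.elim i 0]; exact e
      · right; intro i; rw [Subsingleton.elim i 0]; exact e
    · left
      push Not at hiso
      obtain ⟨v', H', x, hx, hno⟩ := hiso
      obtain ⟨hne, j, A⟩ := iso_att hh hδ hx (by rintro ⟨y, hy, hxy⟩; exact hno y hy hxy)
      obtain ⟨X, hX, hXc⟩ := caseS hconn H' hp1 hδ A hne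
      exact emb_S X hX hXc
  · right; left
    obtain ⟨h3, h55, h82, hM⟩ := C3 hconn H hp2 hh hδ (a := ∑ i, a i) (by omega) (by omega)
      (fun hpp => hF (pair_sum a b₁ (hpp.mono le_rfl (by omega)))) hx0
    subst h3
    have hai : ∀ i, a i = 3 := by
      intro i
      have h1 := ha1 i
      have h2 : a i ≤ ∑ i, a i := Finset.single_le_sum (f := a) (fun _ _ => Nat.zero_le _) (Finset.mem_univ i)
      by_contra hcon
      rcases (by omega : a i = 1 ∨ a i = 2) with e | e
      · exact hF (pair_one a b₁ 3 hsum i (h82.symm.mono (by omega) (by omega)))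
      · exact hF (pair_one a b₁ 3 hsum i (h55.mono (by omega) (by omega)))
    have hs : ∑ i, a i = k * 3 := by
      simp [hai]
    have hne : v 2 ≠ v 5 := fun e => by
      have := H.inj 2 (by omega) 5 (by omega) e
      omega
    exact ⟨by omega, hai, by omega, emb_K hne hM⟩
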